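/- arXiv:1902.05666 — 2 statements merged into one kernel-verified Lean document; each statement's English description precedes it below -/
import Mathlib

section
/- Let F ∈ ℤ[X,Y] be a homogeneous polynomial of degree n ≥ 1 such that either the coefficient of Xⁿ in F equals 1, or the coefficient of Xⁿ equals 0 and the coefficient of Xⁿ⁻¹Y equals 1. Let p be a prime number and let G ∈ ℤ[X,Y] be the primitive part of F(X, p·Y) (that is, F(X, p·Y) divided by its content). Then (a) p is not a fixed prime divisor of G, i.e., there exist integers x, y with p ∤ G(x,y); and (b) every prime q which is a fixed divisor of G is already a fixed divisor of F. -/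
/-- An integer `d` is a fixed divisor of a bivariate integer polynomial `G`
if it divides all of its integer values. -/
def IsFixedDivisor (d : ℤ) (G : MvPolynomial (Fin 2) ℤ) : Prop :=
  ∀ x y : ℤ, d ∣ MvPolynomial.eval ![x, y] G

/-- A bivariate integer polynomial is primitive (of content 1) if the only integers
dividing all of its coefficients are units. -/
def IsPrimitivePoly (G : MvPolynomial (Fin 2) ℤ) : Prop :=
  ∀ d : ℤ, (∀ m, d ∣ G.coeff m) → IsUnit d

/-- Substitution `F(X, N·Y)`. -/
noncomputable def scaleY (N : ℤ) (F : MvPolynomial (Fin 2) ℤ) : MvPolynomial (Fin 2) ℤ :=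
  MvPolynomial.bind₁ ![MvPolynomial.X 0, MvPolynomial.C N * MvPolynomial.X 1] F

open MvPolynomial in
theorem eval_scaleY (N : ℤ) (F : MvPolynomial (Fin 2) ℤ) (x y : ℤ) :
    eval ![x, y] (scaleY N F) = eval ![x, N * y] F := by
  rw [scaleY, ← coe_aeval_eq_eval, ← coe_aeval_eq_eval, RingHom.coe_coe, RingHom.coe_coe,
    aeval_bind₁]
  congr 2
  funext i
  fin_cases i <;> simp

open MvPolynomial in
theorem coeff_scaleY (N : ℤ) (F : MvPolynomial (Fin 2) ℤ) (m : Fin 2 →₀ ℕ) :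
    (scaleY N F).coeff m = N ^ m 1 * F.coeff m := by
  induction F using MvPolynomial.induction_on' with
  | monomial u a =>
    have h : scaleY N (monomial u a) = monomial u (N ^ u 1 * a) := by
      rw [scaleY, bind₁_monomial, monomial_eq (s := u),
        Finsupp.prod_fintype _ _ (fun _ => pow_zero _)]
      have : ∏ i ∈ u.support, ![X 0, C N * X 1] i ^ u i =
          ∏ i : Fin 2, (![X 0, C N * X 1] i : MvPolynomial (Fin 2) ℤ) ^ u i :=
        Finset.prod_subset (Finset.subset_univ _) fun i _ hi => by
          rw [Finsupp.notMem_support_iff.mp hi, pow_zero]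
      rw [this]
      simp only [Fin.prod_univ_two, Matrix.cons_val_zero, Matrix.cons_val_one, C_mul, C_pow]
      ring
    rw [h, coeff_monomial, coeff_monomial]
    split_ifs with hum
    · rw [hum]
    · rw [mul_zero]
  | add P Q hP hQ =>
    have h : scaleY N (P + Q) = scaleY N P + scaleY N Q := map_add _ _ _
    rw [h, coeff_add, coeff_add, hP, hQ, mul_add]

theorem MvPolynomial.IsHomogeneous.eq_of_coeff_ne_zero {F : MvPolynomial (Fin 2) ℤ} {n : ℕ}
    (hF : F.IsHomogeneous n) {m : Fin 2 →₀ ℕ} (hm : F.coeff m ≠ 0) :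
    m = Finsupp.single 0 (n - m 1) + Finsupp.single 1 (m 1) := by
  have h : m 0 + m 1 = n := by
    have := hF hm
    rwa [Finsupp.weight_apply, Finsupp.sum_fintype _ _ (by simp), Fin.sum_univ_two,
      Pi.one_apply, Pi.one_apply, smul_eq_mul, smul_eq_mul, mul_one, mul_one] at this
  ext i
  fin_cases i
  · simp
    omega
  · simp

theorem MvPolynomial.IsHomogeneous.sq_dvd_eval_one_sub {F : MvPolynomial (Fin 2) ℤ} {n : ℕ}
    (hF : F.IsHomogeneous n) (t : ℤ) :
    t ^ 2 ∣ eval ![1, t] F - (F.coeff (Finsupp.single 0 n) +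
      F.coeff (Finsupp.single 0 (n - 1) + Finsupp.single 1 1) * t) := by
  classical
  set e : Fin 2 →₀ ℕ := Finsupp.single 0 n with he
  set e' : Fin 2 →₀ ℕ := Finsupp.single 0 (n - 1) + Finsupp.single 1 1 with he'
  have he1 : e 1 = 0 := by simp [he]
  have he'1 : e' 1 = 1 := by simp [he']
  have hsum : F.coeff e + F.coeff e' * t =
      ∑ m ∈ F.support, ((if m = e then F.coeff m else 0) +
        (if m = e' then F.coeff m * t else 0)) := by
    rw [Finset.sum_add_distrib, Finset.sum_ite_eq', Finset.sum_ite_eq']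
    by_cases h : F.coeff e = 0 <;> by_cases h' : F.coeff e' = 0 <;> simp [h, h']
  rw [hsum, eval_eq', ← Finset.sum_sub_distrib]
  refine Finset.dvd_sum fun m hm => ?_
  have hm' := hF.eq_of_coeff_ne_zero (mem_support_iff.mp hm)
  simp only [Fin.prod_univ_two, Matrix.cons_val_zero, Matrix.cons_val_one, one_pow, one_mul]
  rcases h : m 1 with _ | _ | k
  · have h0 : m = e := by rw [hm', h, he]; simp
    have h1 : m ≠ e' := fun h2 => by rw [h2, he'1] at h; omega
    rw [if_pos h0, if_neg h1]
    simp
  · have h0 : m ≠ e := fun h2 => by rw [h2, he1] at h; omega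
    have h1 : m = e' := by rw [hm', h, he']
    rw [if_neg h0, if_pos h1]
    simp
  · have h0 : m ≠ e := fun h2 => by rw [h2, he1] at h; omega
    have h1 : m ≠ e' := fun h2 => by rw [h2, he'1] at h; omega
    rw [if_neg h0, if_neg h1, add_zero, sub_zero]
    exact Dvd.intro_left (F.coeff m * t ^ k) (by ring)

theorem MvPolynomial.eval_modEq (F : MvPolynomial (Fin 2) ℤ) (q x : ℤ) {y z : ℤ}
    (h : y ≡ z [ZMOD q]) : eval ![x, y] F ≡ eval ![x, z] F [ZMOD q] := by
  rw [eval_eq', eval_eq', Int.modEq_iff_dvd, ← Finset.sum_sub_distrib]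
  refine Finset.dvd_sum fun m _ => ?_
  simp only [Fin.prod_univ_two, Matrix.cons_val_zero, Matrix.cons_val_one]
  exact (((h.pow _).mul_left _).mul_left _).dvd

theorem stmt_1 (F : MvPolynomial (Fin 2) ℤ) (n : ℕ) (hn : 1 ≤ n)
    (hhom : F.IsHomogeneous n)
    (hlead : F.coeff (Finsupp.single 0 n) = 1 ∨
      (F.coeff (Finsupp.single 0 n) = 0 ∧
        F.coeff (Finsupp.single 0 (n - 1) + Finsupp.single 1 1) = 1))
    (p : ℕ) (hp : p.Prime)
    (G : MvPolynomial (Fin 2) ℤ) (hGprim : IsPrimitivePoly G)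
    (hG : ∃ c : ℤ, MvPolynomial.C c * G = scaleY (p : ℤ) F) :
    (∃ x y : ℤ, ¬ ((p : ℤ) ∣ MvPolynomial.eval ![x, y] G)) ∧
    (∀ q : ℕ, q.Prime → IsFixedDivisor (q : ℤ) G → IsFixedDivisor (q : ℤ) F) := by
  obtain ⟨c, hc⟩ := hG
  have hp' : Prime (p : ℤ) := Nat.prime_iff_prime_int.mp hp
  have heval (x y : ℤ) : c * MvPolynomial.eval ![x, y] G = MvPolynomial.eval ![x, p * y] F := by
    rw [← eval_scaleY, ← hc, map_mul, MvPolynomial.eval_C]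
  have hnot : ¬ ((p : ℤ) ∣ MvPolynomial.eval ![1, 1] G) := by
    rintro ⟨g, hg⟩
    obtain ⟨t, ht⟩ := hhom.sq_dvd_eval_one_sub (p : ℤ)
    have h11 := heval 1 1
    rw [mul_one, hg] at h11
    rw [← h11] at ht
    rcases hlead with h0 | ⟨h0, h1⟩
    · rw [h0] at ht
      refine hp'.not_dvd_one ⟨c * g - p * t -
        F.coeff (Finsupp.single 0 (n - 1) + Finsupp.single 1 1), ?_⟩
      linear_combination -ht
    · have hcoeff (m : Fin 2 →₀ ℕ) : (p : ℤ) ∣ c * G.coeff m := by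
        rw [← MvPolynomial.coeff_C_mul, hc, coeff_scaleY]
        by_cases hm : F.coeff m = 0
        · simp [hm]
        · refine Dvd.dvd.mul_right (dvd_pow_self _ fun hm1 => hm ?_) _
          rw [hhom.eq_of_coeff_ne_zero hm, hm1]
          simpa using h0
      have hpc : (p : ℤ) ∣ c := by
        by_contra hpc
        exact hp'.not_isUnit (hGprim p fun m => (hp'.dvd_or_dvd (hcoeff m)).resolve_left hpc)
      obtain ⟨d, rfl⟩ := hpc
      rw [h0, h1] at ht
      refine hp'.not_dvd_one ⟨d * g - t, mul_left_cancel₀ hp'.ne_zero ?_⟩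
      linear_combination -ht
  refine ⟨⟨1, 1, hnot⟩, fun q hq hqG x y => ?_⟩
  have hqp : q ≠ p := by
    rintro rfl
    exact hnot (hqG 1 1)
  have hcop : IsCoprime (p : ℤ) (q : ℤ) :=
    Nat.isCoprime_iff_coprime.mpr ((Nat.coprime_primes hp hq).mpr hqp.symm)
  obtain ⟨a, b, hab⟩ := hcop
  have hmod : (p : ℤ) * (a * y) ≡ y [ZMOD q] :=
    Int.modEq_iff_dvd.mpr ⟨b * y, by linear_combination (-y) * hab⟩
  rw [← (F.eval_modEq q x hmod).dvd_iff, ← heval]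
  exact (hqG _ _).mul_left c
end

section
/- Let f ∈ ℤ[X] be a nonconstant separable polynomial (f has no repeated roots over ℚ). Assume the abc-conjecture. Then there exists N₀ ∈ ℕ such that for every prime p ≥ N₀ and every integer k with p ∤ k, there are infinitely many squarefree integers d with d ≡ k (mod p) such that the quadratic twist d·Y² = f(X) of the hyperelliptic curve Y² = f(X) has a non-trivial rational point, i.e., there exist x, y ∈ ℚ with y ≠ 0 and d·y² = f(x). -/
/-- The radical of a natural number: the product of its distinct prime factors. -/
def Rad (m : ℕ) : ℕ := ∏ q ∈ m.primeFactors, q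

/-- The abc-conjecture: for every `ε > 0` there is a constant `C > 0` such that
`c ≤ C · rad(abc)^(1+ε)` for all coprime positive integers `a + b = c`. -/
def AbcConjecture : Prop :=
  ∀ ε : ℝ, 0 < ε → ∃ C : ℝ, 0 < C ∧ ∀ a b c : ℕ, 0 < a → 0 < b → 0 < c →
    Nat.Coprime a b → a + b = c → (c : ℝ) ≤ C * (Rad (a * b * c) : ℝ) ^ (1 + ε)

open Polynomial

/-- Some nonzero polynomial of degree at most `deg d` sends the values of `h` at roots of `d` to `0`. -/
lemma exists_dvd_comp (h d : ℚ[X]) (hd : d ≠ 0) :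
    ∃ e : ℚ[X], e ≠ 0 ∧ e.natDegree ≤ d.natDegree ∧ d ∣ e.comp h := by
  have : Module.Finite ℚ (AdjoinRoot d) := (AdjoinRoot.powerBasis hd).finite
  refine ⟨(Algebra.lmul ℚ (AdjoinRoot d) (AdjoinRoot.mk d h)).charpoly,
    (LinearMap.charpoly_monic _).ne_zero, ?_, ?_⟩
  · rw [LinearMap.charpoly_natDegree, (AdjoinRoot.powerBasis hd).finrank,
      AdjoinRoot.powerBasis_dim]
  · have h1 := LinearMap.aeval_self_charpoly (Algebra.lmul ℚ (AdjoinRoot d) (AdjoinRoot.mk d h))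
    rw [Polynomial.aeval_algHom_apply] at h1
    have h2 := Algebra.lmul_injective (R := ℚ) (h1.trans (map_zero _).symm)
    have h3 : ∀ q : ℚ[X], AdjoinRoot.mk d (q.comp h) = aeval (AdjoinRoot.mk d h) q := fun q => by
      rw [← AdjoinRoot.aeval_eq, aeval_comp, AdjoinRoot.aeval_eq]
    rw [← AdjoinRoot.mk_eq_zero, h3, h2]

lemma exists_rational_values (N : ℕ) (h : ℚ[X]) (h0 : h ≠ 0) (hN : h.natDegree ≤ N) :
    ∃ ψ : ℚ[X], 0 < ψ.natDegree ∧ ∀ β : ℂ, aeval β h = 0 ∨ aeval β (derivative ψ) = 0 →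
      ∃ s : ℚ, aeval β ψ = (s : ℂ) := by
  induction N generalizing h with
  | zero =>
    obtain ⟨a, rfl⟩ := natDegree_eq_zero.mp (Nat.le_zero.mp hN)
    refine ⟨X, by simp, fun β hβ => ?_⟩
    have ha : a ≠ 0 := by simpa using h0
    simp [ha] at hβ
  | succ N ih =>
    by_cases hd : derivative h = 0
    · exact ih h h0 (by rw [derivative_eq_zero.mp hd]; exact Nat.zero_le _)
    · obtain ⟨e, he0, hedeg, hdvd⟩ := exists_dvd_comp h (derivative h) hd
      have hpos : 0 < h.natDegree := by
        by_contra hc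
        obtain ⟨a, rfl⟩ := natDegree_eq_zero.mp (Nat.eq_zero_of_not_pos hc)
        simp at hd
      have hlt := natDegree_derivative_lt hpos.ne'
      obtain ⟨ψ, hψ, hval⟩ := ih e he0 (by omega)
      refine ⟨ψ.comp h, by rw [natDegree_comp]; positivity, fun β hβ => ?_⟩
      rw [derivative_comp, map_mul, mul_eq_zero, aeval_comp] at hβ
      rw [aeval_comp]
      rcases hβ with hβ | hβ | hβ
      · rw [hβ]
        exact ⟨ψ.coeff 0, by simp [← coeff_zero_eq_aeval_zero']⟩
      · apply hval
        left
        obtain ⟨r, hr⟩ := hdvd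
        rw [← aeval_comp, hr, map_mul, hβ, zero_mul]
      · exact hval _ (Or.inr hβ)

lemma exists_binary_values (N : ℕ) (S : Finset ℚ) (hS : S.card ≤ N) :
    ∃ χ : ℚ[X], 0 < χ.natDegree ∧ (∀ s ∈ S, χ.eval s = 0 ∨ χ.eval s = 1) ∧
      ∀ β : ℂ, aeval β (derivative χ) = 0 → aeval β χ = 0 ∨ aeval β χ = 1 := by
  induction N generalizing S with
  | zero =>
    have : S = ∅ := by simpa using hS
    subst this
    exact ⟨X, by simp, by simp, by simp⟩
  | succ N ih =>
    by_cases h3 : S.card ≤ 2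
    · have : ∃ a b : ℚ, a ≠ b ∧ S ⊆ {a, b} := by
        interval_cases hc : S.card
        · exact ⟨0, 1, by norm_num, by simp [Finset.card_eq_zero.mp hc]⟩
        · obtain ⟨a, rfl⟩ := Finset.card_eq_one.mp hc
          exact ⟨a, a + 1, by simp, by simp⟩
        · obtain ⟨a, b, hab, rfl⟩ := Finset.card_eq_two.mp hc
          exact ⟨a, b, hab, le_rfl⟩
      obtain ⟨a, b, hab, hsub⟩ := this
      have hba : b - a ≠ 0 := sub_ne_zero.mpr hab.symm
      refine ⟨C ((b - a)⁻¹) * (X - C a), ?_, ?_, ?_⟩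
      · rw [natDegree_C_mul (inv_ne_zero hba)]; simp
      · intro s hs
        have := hsub hs
        simp only [Finset.mem_insert, Finset.mem_singleton] at this
        rcases this with rfl | rfl
        · simp
        · right; simp [hba]
      · intro β hβ
        exfalso
        simp only [derivative_mul, derivative_C, derivative_sub, derivative_X] at hβ
        simp at hβ
        exact hba (by exact_mod_cast hβ)
    · have : ∃ a ∈ S, ∃ b ∈ S, ∃ c ∈ S, a < b ∧ b < c := by
        have hne : S.Nonempty := Finset.card_pos.mp (by omega)
        have hmm : ((S.erase (S.min' hne)).erase (S.max' hne)).Nonempty := by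
          apply Finset.card_pos.mp
          have h1 := Finset.pred_card_le_card_erase (s := S) (a := S.min' hne)
          have h2 := Finset.pred_card_le_card_erase (s := S.erase (S.min' hne)) (a := S.max' hne)
          omega
        obtain ⟨b, hb⟩ := hmm
        simp only [Finset.mem_erase] at hb
        exact ⟨_, S.min'_mem hne, b, hb.2.2, _, S.max'_mem hne,
          lt_of_le_of_ne (S.min'_le _ hb.2.2) (Ne.symm hb.2.1),
          lt_of_le_of_ne (S.le_max' _ hb.2.2) hb.1⟩
      obtain ⟨a, ha, b, hb, c, hc, hab, hbc⟩ := this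
      have : ∃ m n : ℕ, 0 < m ∧ 0 < n ∧ (m : ℚ) * (c - b) = n * (b - a) := by
        have hu : 0 < b - a := sub_pos.mpr hab
        have hv : 0 < c - b := sub_pos.mpr hbc
        generalize b - a = u at hu ⊢
        generalize c - b = v at hv ⊢
        refine ⟨u.num.toNat * v.den, v.num.toNat * u.den, ?_, ?_, ?_⟩
        · have := Rat.num_pos.mpr hu
          exact Nat.mul_pos (by omega) v.den_pos
        · have := Rat.num_pos.mpr hv
          exact Nat.mul_pos (by omega) u.den_pos
        · have h1 : ((u.num.toNat : ℤ) : ℚ) = u.num := by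
            rw [Int.toNat_of_nonneg (Rat.num_pos.mpr hu).le]
          have h2 : ((v.num.toNat : ℤ) : ℚ) = v.num := by
            rw [Int.toNat_of_nonneg (Rat.num_pos.mpr hv).le]
          have h3 := Rat.mul_den_eq_num u
          have h4 := Rat.mul_den_eq_num v
          push_cast at h1 h2 ⊢
          rw [h1, h2, ← h3, ← h4]
          ring
      obtain ⟨m, n, hm, hn, hmn⟩ := this
      obtain ⟨m, rfl⟩ := Nat.exists_eq_succ_of_ne_zero hm.ne'
      obtain ⟨n, rfl⟩ := Nat.exists_eq_succ_of_ne_zero hn.ne'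
      set κ : ℚ := ((b - a) ^ (m + 1) * (c - b) ^ (n + 1))⁻¹ with hκ
      have hκ0 : κ ≠ 0 := by
        have := sub_pos.mpr hab
        have := sub_pos.mpr hbc
        positivity
      set μ : ℚ[X] := C κ * ((X - C a) ^ (m + 1) * (C c - X) ^ (n + 1)) with hμ
      have hcX : (C c - X : ℚ[X]) = -(X - C c) := by ring
      have hμdeg : 0 < μ.natDegree := by
        rw [hμ, natDegree_C_mul hκ0, hcX, natDegree_mul (pow_ne_zero _ (X_sub_C_ne_zero a))
          (pow_ne_zero _ (neg_ne_zero.mpr (X_sub_C_ne_zero c))), natDegree_pow, natDegree_pow]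
        simp
      have hμa : μ.eval a = 0 := by simp [hμ]
      have hμc : μ.eval c = 0 := by simp [hμ]
      have hμb : μ.eval b = 1 := by
        simp only [hμ, eval_mul, eval_C, eval_pow, eval_sub, eval_X]
        rw [hκ]; apply inv_mul_cancel₀
        have := sub_pos.mpr hab
        have := sub_pos.mpr hbc
        positivity
      have hcrit : ∀ β : ℂ, aeval β (derivative μ) = 0 → β = a ∨ β = b ∨ β = c := by
        intro β hβ
        simp only [hμ, derivative_mul, derivative_C, derivative_pow,
          derivative_X, map_mul, map_add, map_pow, map_sub, aeval_C, aeval_X, map_zero, map_one, map_natCast] at hβ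
        simp only [eq_ratCast, Nat.add_sub_cancel, Nat.cast_add, Nat.cast_one] at hβ
        by_contra! hne
        have h1 : β - a ≠ 0 := sub_ne_zero.mpr hne.1
        have h2 : (c : ℂ) - β ≠ 0 := sub_ne_zero.mpr (Ne.symm hne.2.2)
        have h3 : (κ : ℂ) ≠ 0 := by exact_mod_cast hκ0
        have h4 : (κ : ℂ) * ((β - a) ^ m * (c - β) ^ n) *
            ((m + 1) * (c - β) - (n + 1) * (β - a)) = 0 := by
          linear_combination hβ
        rw [mul_eq_zero] at h4
        have h5 := h4.resolve_left (mul_ne_zero h3 (mul_ne_zero (pow_ne_zero _ h1) (pow_ne_zero _ h2)))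
        have h6 : ((m : ℂ) + 1) * (c - b) = (n + 1) * (b - a) := by exact_mod_cast hmn
        have h7 : ((m : ℂ) + 1 + (n + 1)) * (β - b) = 0 := by linear_combination h6 - h5
        have h8 : ((m : ℂ) + 1 + (n + 1)) ≠ 0 := by
          have : m + 1 + (n + 1) ≠ 0 := by omega
          exact_mod_cast this
        exact hne.2.1 (sub_eq_zero.mp ((mul_eq_zero.mp h7).resolve_left h8))
      have hcard : (S.image fun s => μ.eval s).card ≤ N := by
        have h1 : (S.image fun s => μ.eval s) = (S.erase a).image fun s => μ.eval s := by
          apply Finset.Subset.antisymm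
          · intro y hy
            obtain ⟨s, hs, rfl⟩ := Finset.mem_image.mp hy
            by_cases hsa : s = a
            · refine Finset.mem_image.mpr ⟨c, Finset.mem_erase.mpr ⟨(hab.trans hbc).ne', hc⟩, ?_⟩
              rw [hμc, hsa, hμa]
            · exact Finset.mem_image_of_mem _ (Finset.mem_erase.mpr ⟨hsa, hs⟩)
          · exact Finset.image_subset_image (Finset.erase_subset _ _)
        rw [h1]
        refine Finset.card_image_le.trans ?_
        rw [Finset.card_erase_of_mem ha]
        omega
      obtain ⟨χ, hχ, hχS, hχc⟩ := ih _ hcard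
      refine ⟨χ.comp μ, by rw [natDegree_comp]; positivity, ?_, ?_⟩
      · intro s hs
        rw [eval_comp]
        exact hχS _ (Finset.mem_image_of_mem _ hs)
      · intro β hβ
        rw [derivative_comp, map_mul, mul_eq_zero, aeval_comp] at hβ
        rw [aeval_comp]
        rcases hβ with hβ | hβ
        · have key : ∀ s ∈ S, aeval (aeval (s : ℂ) μ) χ = 0 ∨ aeval (aeval (s : ℂ) μ) χ = 1 := by
            intro s hs
            have h1 := hχS _ (Finset.mem_image_of_mem (fun s => μ.eval s) hs)
            have h2 : aeval (s : ℂ) μ = ((μ.eval s : ℚ) : ℂ) := by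
              simpa using aeval_algebraMap_apply ℂ s μ
            have h3 : aeval (((μ.eval s : ℚ) : ℂ)) χ = ((χ.eval (μ.eval s) : ℚ) : ℂ) := by
              simpa using aeval_algebraMap_apply ℂ (μ.eval s) χ
            rw [h2, h3]
            exact_mod_cast h1
          rcases hcrit β hβ with rfl | rfl | rfl
          · exact key _ ha
          · exact key _ hb
          · exact key _ hc
        · exact hχc _ hβ

lemma exists_belyi (g : ℚ[X]) (hg : g ≠ 0) :
    ∃ φ : ℚ[X], 0 < φ.natDegree ∧ ∀ β : ℂ, aeval β g = 0 ∨ aeval β (derivative φ) = 0 →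
      aeval β φ = 0 ∨ aeval β φ = 1 := by
  obtain ⟨ψ, hψ, hval⟩ := exists_rational_values _ g hg le_rfl
  have hd : derivative ψ ≠ 0 := fun h => hψ.ne' (derivative_eq_zero.mp h)
  have hfin : {s : ℚ | ∃ β : ℂ, aeval β (g * derivative ψ) = 0 ∧ aeval β ψ = (s : ℂ)}.Finite := by
    refine Set.Finite.of_finite_image (f := fun s : ℚ => (s : ℂ)) ?_ Rat.cast_injective.injOn
    refine (((g * derivative ψ).rootSet_finite ℂ).image fun β => aeval β ψ).subset ?_
    rintro _ ⟨s, ⟨β, h1, h2⟩, rfl⟩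
    exact ⟨β, (mem_rootSet_of_ne (mul_ne_zero hg hd)).mpr h1, h2⟩
  obtain ⟨χ, hχ, hχS, hχc⟩ := exists_binary_values _ hfin.toFinset le_rfl
  have key : ∀ β : ℂ, aeval β g = 0 ∨ aeval β (derivative ψ) = 0 →
      aeval β (χ.comp ψ) = 0 ∨ aeval β (χ.comp ψ) = 1 := by
    intro β hβ
    obtain ⟨s, hs⟩ := hval β hβ
    have h1 := hχS s (hfin.mem_toFinset.mpr ⟨β, by rw [map_mul, mul_eq_zero]; exact hβ, hs⟩)
    have h3 : aeval (s : ℂ) χ = ((χ.eval s : ℚ) : ℂ) := by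
      simpa using aeval_algebraMap_apply ℂ s χ
    rw [aeval_comp, hs, h3]
    exact_mod_cast h1
  refine ⟨χ.comp ψ, by rw [natDegree_comp]; positivity, fun β hβ => ?_⟩
  rcases hβ with hβ | hβ
  · exact key β (Or.inl hβ)
  · rw [derivative_comp, map_mul, mul_eq_zero] at hβ
    rcases hβ with hβ | hβ
    · exact key β (Or.inr hβ)
    · rw [aeval_comp] at hβ ⊢
      exact hχc _ hβ

lemma dvd_of_rootMultiplicity_le {p q : ℚ[X]} (hp : p ≠ 0) (hq : q ≠ 0)
    (h : ∀ β : ℂ, aeval β p = 0 → (p.map (algebraMap ℚ ℂ)).rootMultiplicity β ≤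
      (q.map (algebraMap ℚ ℂ)).rootMultiplicity β) : p ∣ q := by
  rw [← map_dvd_map' (algebraMap ℚ ℂ), IsAlgClosed.dvd_iff_roots_le_roots
    ((Polynomial.map_ne_zero_iff (algebraMap ℚ ℂ).injective).mpr hp)
    ((Polynomial.map_ne_zero_iff (algebraMap ℚ ℂ).injective).mpr hq), Multiset.le_iff_count]
  intro β
  rw [count_roots, count_roots]
  by_cases hβ : aeval β p = 0
  · exact h β hβ
  · rw [rootMultiplicity_eq_zero]
    · exact Nat.zero_le _
    · rwa [IsRoot, eval_map_algebraMap]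

lemma exists_belyi_cofactor (g : ℚ[X]) (hg : g.Separable) :
    ∃ φ G : ℚ[X], ∃ k : ℕ, 0 < φ.natDegree ∧ G ≠ 0 ∧ G.natDegree ≤ φ.natDegree + 1 ∧ g ∣ G ∧
      φ * (φ - 1) ∣ G ^ k := by
  obtain ⟨φ, hφ, hval⟩ := exists_belyi g hg.ne_zero
  have hφ0 : φ ≠ 0 := ne_zero_of_natDegree_gt hφ
  have hdeg1 : (φ - 1).natDegree = φ.natDegree := by
    rw [← C_1, natDegree_sub_C]
  have hφ1 : φ - 1 ≠ 0 := ne_zero_of_natDegree_gt (hdeg1.symm ▸ hφ)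
  have hd0 : derivative φ ≠ 0 := fun h => hφ.ne' (derivative_eq_zero.mp h)
  have hP0 : φ * (φ - 1) ≠ 0 := mul_ne_zero hφ0 hφ1
  have hinj := (algebraMap ℚ ℂ).injective
  have hm0 : ∀ {p : ℚ[X]}, p ≠ 0 → p.map (algebraMap ℚ ℂ) ≠ 0 := fun hp =>
    (Polynomial.map_ne_zero_iff hinj).mpr hp
  have hroot : ∀ (p : ℚ[X]) (β : ℂ), (p.map (algebraMap ℚ ℂ)).IsRoot β ↔ aeval β p = 0 :=
    fun p β => by rw [IsRoot, eval_map_algebraMap]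
  have hmult : ∀ β : ℂ, aeval β φ = 0 ∨ aeval β φ = 1 →
      ((φ * (φ - 1)).map (algebraMap ℚ ℂ)).rootMultiplicity β =
        ((derivative φ).map (algebraMap ℚ ℂ)).rootMultiplicity β + 1 := by
    intro β hβ
    rw [Polynomial.map_mul, rootMultiplicity_mul (mul_ne_zero (hm0 hφ0) (hm0 hφ1))]
    rcases hβ with hβ | hβ
    · have h1 : ((φ - 1).map (algebraMap ℚ ℂ)).rootMultiplicity β = 0 := by
        rw [rootMultiplicity_eq_zero]
        rw [hroot]; simp [hβ]
      have h2 := (rootMultiplicity_pos (hm0 hφ0)).mpr ((hroot φ β).mpr hβ)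
      have h3 := derivative_rootMultiplicity_of_root ((hroot φ β).mpr hβ)
      rw [derivative_map] at h3
      omega
    · have h1 : (φ.map (algebraMap ℚ ℂ)).rootMultiplicity β = 0 := by
        rw [rootMultiplicity_eq_zero]
        rw [hroot]; simp [hβ]
      have hr : ((φ - 1).map (algebraMap ℚ ℂ)).IsRoot β := by rw [hroot]; simp [hβ]
      have h2 := (rootMultiplicity_pos (hm0 hφ1)).mpr hr
      have h3 := derivative_rootMultiplicity_of_root hr
      rw [derivative_map, derivative_sub, derivative_one, sub_zero] at h3
      omega
  have hdvd : derivative φ ∣ φ * (φ - 1) := by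
    refine dvd_of_rootMultiplicity_le hd0 hP0 fun β hβ => ?_
    rw [hmult β (hval β (Or.inr hβ))]
    exact Nat.le_succ _
  obtain ⟨G, hG⟩ := hdvd
  have hG0 : G ≠ 0 := by
    rintro rfl
    exact hP0 (by rw [hG, mul_zero])
  have hGmult : ∀ β : ℂ, aeval β φ = 0 ∨ aeval β φ = 1 →
      (G.map (algebraMap ℚ ℂ)).rootMultiplicity β = 1 := by
    intro β hβ
    have h1 := hmult β hβ
    rw [hG, Polynomial.map_mul, rootMultiplicity_mul (mul_ne_zero (hm0 hd0) (hm0 hG0))] at h1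
    omega
  refine ⟨φ, G, (φ * (φ - 1)).natDegree, hφ, hG0, ?_, ?_, ?_⟩
  · have h1 := congrArg natDegree hG
    rw [natDegree_mul hφ0 hφ1, natDegree_mul hd0 hG0, hdeg1, natDegree_derivative] at h1
    omega
  · refine dvd_of_rootMultiplicity_le hg.ne_zero hG0 fun β hβ => ?_
    rw [hGmult β (hval β (Or.inl hβ))]
    exact rootMultiplicity_le_one_of_separable ((separable_map _).mpr hg) β
  · refine dvd_of_rootMultiplicity_le hP0 (pow_ne_zero _ hG0) fun β hβ => ?_
    have h1 : aeval β φ = 0 ∨ aeval β φ = 1 := by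
      rw [map_mul, mul_eq_zero, map_sub, map_one, sub_eq_zero] at hβ
      exact hβ
    have hGβ : (X - C β) ∣ G.map (algebraMap ℚ ℂ) := by
      rw [dvd_iff_isRoot, ← rootMultiplicity_pos (hm0 hG0), hGmult β h1]
      exact Nat.one_pos
    classical
    calc ((φ * (φ - 1)).map (algebraMap ℚ ℂ)).rootMultiplicity β
        ≤ ((φ * (φ - 1)).map (algebraMap ℚ ℂ)).natDegree := by
          rw [← count_roots]
          exact (Multiset.count_le_card _ _).trans (card_roots' _)
      _ = (φ * (φ - 1)).natDegree := natDegree_map_eq_of_injective hinj _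
      _ ≤ _ := by
          rw [le_rootMultiplicity_iff (hm0 (pow_ne_zero _ hG0)), Polynomial.map_pow]
          exact pow_dvd_pow_of_dvd hGβ _

lemma Rad_pos (m : ℕ) : 0 < Rad m :=
  Finset.prod_pos fun _ hq => (Nat.prime_of_mem_primeFactors hq).pos

lemma Rad_le_self {m : ℕ} (hm : m ≠ 0) : Rad m ≤ m :=
  Nat.le_of_dvd (Nat.pos_of_ne_zero hm) (Nat.prod_primeFactors_dvd m)

lemma Rad_le_of_dvd {m n : ℕ} (h : m ∣ n) (hn : n ≠ 0) : Rad m ≤ Rad n :=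
  Finset.prod_le_prod_of_subset_of_one_le' (Nat.primeFactors_mono h hn)
    fun _ hq _ => (Nat.prime_of_mem_primeFactors hq).one_le

lemma Rad_mul_le {m n : ℕ} (hm : m ≠ 0) (hn : n ≠ 0) : Rad (m * n) ≤ Rad m * Rad n := by
  unfold Rad
  rw [Nat.primeFactors_mul hm hn, ← Finset.prod_union_inter]
  exact Nat.le_mul_of_pos_right _
    (Finset.prod_pos fun _ hq => (Nat.prime_of_mem_primeFactors (Finset.mem_inter.mp hq).1).pos)

lemma Rad_pow (m : ℕ) {k : ℕ} (hk : k ≠ 0) : Rad (m ^ k) = Rad m := by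
  rw [Rad, Nat.primeFactors_pow m hk, Rad]

lemma mul_Rad_le {m n : ℕ} (h : m ^ 2 ∣ n) (hn : n ≠ 0) : m * Rad n ≤ n := by
  obtain ⟨j, rfl⟩ := h
  have hm : m ≠ 0 := by rintro rfl; simp at hn
  have hj : j ≠ 0 := by rintro rfl; simp at hn
  calc m * Rad (m ^ 2 * j) ≤ m * Rad ((m * j) ^ 2) := by
        refine Nat.mul_le_mul_left _ (Rad_le_of_dvd ⟨j, by ring⟩ (by positivity))
    _ ≤ m * (m * j) := by
        rw [Rad_pow _ two_ne_zero]
        exact Nat.mul_le_mul_left _ (Rad_le_self (by positivity))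
    _ = m ^ 2 * j := by ring

/-- The abc inequality without coprimality, when one of the summands is fixed. -/
lemma AbcConjecture.exists_fixed_summand (habc : AbcConjecture) {ε : ℝ} (hε : 0 < ε) (B : ℕ)
    (hB : 0 < B) :
    ∃ K : ℝ, 0 < K ∧ ∀ b : ℕ, 0 < b →
      ((B + b : ℕ) : ℝ) ≤ K * (Rad (b * (B + b)) : ℝ) ^ (1 + ε) := by
  obtain ⟨K, hK, h⟩ := habc ε hε
  refine ⟨B * K * (B : ℝ) ^ (1 + ε), by positivity, fun b hb => ?_⟩
  obtain ⟨δ, a', b', hδ, hcop, ha', hb'⟩ := Nat.exists_coprime' (m := B) (n := b)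
    (Nat.gcd_pos_of_pos_left _ hB)
  have ha0 : 0 < a' := by
    rcases Nat.eq_zero_or_pos a' with rfl | h'
    · omega
    · exact h'
  have hb0 : 0 < b' := by
    rcases Nat.eq_zero_or_pos b' with rfl | h'
    · omega
    · exact h'
  have h1 := h a' b' (a' + b') ha0 hb0 (by omega) hcop rfl
  have hδB : δ ≤ B := by rw [ha']; exact Nat.le_mul_of_pos_left _ ha0
  have h2 : Rad (a' * b' * (a' + b')) ≤ B * Rad (b * (B + b)) := by
    calc Rad (a' * b' * (a' + b')) ≤ Rad (B * (b * (B + b))) := by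
          refine Rad_le_of_dvd ⟨δ ^ 3, ?_⟩ (by positivity)
          rw [ha', hb']; ring
      _ ≤ Rad B * Rad (b * (B + b)) := Rad_mul_le hB.ne' (by positivity)
      _ ≤ _ := Nat.mul_le_mul_right _ (Rad_le_self hB.ne')
  have h3 : ((Rad (a' * b' * (a' + b')) : ℕ) : ℝ) ≤ B * Rad (b * (B + b)) := by exact_mod_cast h2
  calc ((B + b : ℕ) : ℝ) = δ * ((a' + b' : ℕ) : ℝ) := by
        rw [ha', hb']; push_cast; ring
    _ ≤ B * (K * (Rad (a' * b' * (a' + b')) : ℝ) ^ (1 + ε)) := by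
        gcongr
    _ ≤ B * (K * (B * Rad (b * (B + b)) : ℝ) ^ (1 + ε)) := by
        gcongr
    _ = _ := by
        rw [Real.mul_rpow (by positivity) (by positivity)]; ring

lemma AbcConjecture.exists_int_bound (habc : AbcConjecture) {ε : ℝ} (hε : 0 < ε) (B : ℕ)
    (hB : 0 < B) :
    ∃ K : ℝ, 0 < K ∧ ∀ A : ℤ, A ≠ 0 → A ≠ B →
      |(A : ℝ)| ≤ K * (Rad (A * (A - B)).natAbs : ℝ) ^ (1 + ε) := by
  obtain ⟨K, hK, h⟩ := habc.exists_fixed_summand hε B hB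
  refine ⟨max K B, lt_max_of_lt_left hK, fun A hA hAB => ?_⟩
  have hpos : (0 : ℝ) ≤ (Rad (A * (A - B)).natAbs : ℝ) ^ (1 + ε) := by positivity
  rcases lt_or_gt_of_ne hA with hneg | hApos
  · obtain ⟨b, rfl⟩ : ∃ b : ℕ, A = -b := ⟨A.natAbs, by omega⟩
    have hb : 0 < b := by omega
    have h1 : (-(b : ℤ) * (-(b : ℤ) - B)).natAbs = b * (B + b) := by
      rw [show (-(b : ℤ) * (-(b : ℤ) - B)) = ((b * (B + b) : ℕ) : ℤ) by push_cast; ring,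
        Int.natAbs_natCast]
    rw [h1] at hpos ⊢
    calc |((-(b : ℤ) : ℤ) : ℝ)| ≤ ((B + b : ℕ) : ℝ) := by
          push_cast; rw [abs_neg, abs_of_nonneg (by positivity)]
          linarith [(Nat.cast_nonneg B : (0 : ℝ) ≤ B)]
      _ ≤ _ := (h b hb).trans (mul_le_mul_of_nonneg_right (le_max_left _ _) hpos)
  · rcases lt_or_gt_of_ne hAB with hlt | hgt
    · have h1 : (1 : ℝ) ≤ (Rad (A * (A - B)).natAbs : ℝ) ^ (1 + ε) :=
        Real.one_le_rpow (by exact_mod_cast Rad_pos _) (by positivity)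
      have h2 : |(A : ℝ)| ≤ B := by
        rw [abs_of_pos (by exact_mod_cast hApos)]; exact_mod_cast hlt.le
      calc |(A : ℝ)| ≤ max K B := h2.trans (le_max_right _ _)
        _ ≤ _ := le_mul_of_one_le_right (le_max_of_le_left hK.le) h1
    · obtain ⟨b, rfl⟩ : ∃ b : ℕ, A = B + b := ⟨(A - B).natAbs, by omega⟩
      have hb : 0 < b := by omega
      have h1 : (((B : ℤ) + b) * ((B : ℤ) + b - B)).natAbs = b * (B + b) := by
        rw [show (((B : ℤ) + b) * ((B : ℤ) + b - B)) = ((b * (B + b) : ℕ) : ℤ) by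
          push_cast; ring, Int.natAbs_natCast]
      rw [h1] at hpos ⊢
      calc |((((B : ℤ) + b) : ℤ) : ℝ)| = ((B + b : ℕ) : ℝ) := by
            push_cast; rw [abs_of_nonneg (by positivity)]
        _ ≤ _ := (h b hb).trans (mul_le_mul_of_nonneg_right (le_max_left _ _) hpos)

lemma exists_int_multiple (p : ℚ[X]) :
    ∃ N : ℕ, 0 < N ∧ ∃ q : ℤ[X], q.map (Int.castRingHom ℚ) = C (N : ℚ) * p := by
  obtain ⟨b, hb, h⟩ := IsLocalization.integerNormalization_spec (nonZeroDivisors ℤ) p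
  have hb0 : b ≠ 0 := nonZeroDivisors.ne_zero hb
  refine ⟨b.natAbs, Int.natAbs_pos.mpr hb0,
    C b.sign * IsLocalization.integerNormalization (nonZeroDivisors ℤ) p, ?_⟩
  have h' : (IsLocalization.integerNormalization (nonZeroDivisors ℤ) p).map (Int.castRingHom ℚ) =
      C (b : ℚ) * p := by
    rw [← smul_eq_C_mul, Int.cast_smul_eq_zsmul]
    exact h
  rw [Polynomial.map_mul, h', ← mul_assoc, Polynomial.map_C, ← C_mul, eq_intCast, ← Int.cast_mul,
    Int.sign_mul_self_eq_natAbs, Int.cast_natCast]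

lemma eval_abs_le_mul_pow (p : ℤ[X]) {n : ℕ} (hn : p.natDegree ≤ n) :
    ∃ K : ℝ, 0 < K ∧ ∀ᶠ t : ℕ in Filter.atTop, |((p.eval (t : ℤ) : ℤ) : ℝ)| ≤ K * (t : ℝ) ^ n := by
  have h := Polynomial.isBigO_atTop_of_degree_le (𝕜 := ℝ) (p.map (Int.castRingHom ℝ)) (X ^ n) (by
    rw [degree_X_pow]; exact degree_map_le.trans (natDegree_le_iff_degree_le.mp hn))
  obtain ⟨K, hK, hO⟩ := h.exists_pos
  refine ⟨K, hK, ?_⟩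
  filter_upwards [tendsto_natCast_atTop_atTop.eventually hO.bound] with t ht
  simpa [eval_intCast_map] using ht

lemma mul_pow_le_eval_abs (p : ℤ[X]) (hp : p ≠ 0) :
    ∃ K : ℝ, 0 < K ∧ ∀ᶠ t : ℕ in Filter.atTop,
      K * (t : ℝ) ^ p.natDegree ≤ |((p.eval (t : ℤ) : ℤ) : ℝ)| := by
  have hinj : Function.Injective (Int.castRingHom ℝ) := Int.cast_injective
  have h := Polynomial.isBigO_atTop_of_degree_le (𝕜 := ℝ) (X ^ p.natDegree) (p.map (Int.castRingHom ℝ))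
    (by rw [degree_X_pow, degree_map_eq_of_injective hinj, degree_eq_natDegree hp])
  obtain ⟨K, hK, hO⟩ := h.exists_pos
  refine ⟨K⁻¹, inv_pos.mpr hK, ?_⟩
  filter_upwards [tendsto_natCast_atTop_atTop.eventually hO.bound] with t ht
  rw [inv_mul_le_iff₀ hK]
  simpa [eval_intCast_map] using ht

/-- Under the abc-conjecture, the square part of a separable polynomial at `t` is `O(t ^ (5 / 2))`. -/
lemma AbcConjecture.square_divisor_bound (habc : AbcConjecture) (g : ℤ[X])
    (hg : (g.map (Int.castRingHom ℚ)).Separable) :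
    ∃ K : ℝ, 0 < K ∧ ∀ᶠ t : ℕ in Filter.atTop, ∀ m : ℕ, (m : ℤ) ^ 2 ∣ g.eval (t : ℤ) →
      (m : ℝ) ≤ K * (t : ℝ) ^ (5 / 4 : ℝ) := by
  have hinj : Function.Injective (Int.castRingHom ℚ) := Int.cast_injective
  obtain ⟨φ, G, k, hφ, hG0, hGdeg, ⟨H, hH⟩, ⟨U, hU⟩⟩ := exists_belyi_cofactor _ hg
  obtain ⟨B, hB, A, hA⟩ := exists_int_multiple φ
  obtain ⟨N₂, hN₂, H₁, hH₁⟩ := exists_int_multiple H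
  obtain ⟨N₃, hN₃, U₁, hU₁⟩ := exists_int_multiple U
  have hBQ : (B : ℚ) ≠ 0 := by exact_mod_cast hB.ne'
  have hG₁ : (g * H₁).map (Int.castRingHom ℚ) = C (N₂ : ℚ) * G := by
    rw [Polynomial.map_mul, hH₁, hH]; ring
  have hG₁0 : g * H₁ ≠ 0 := by
    intro h0
    rw [h0, Polynomial.map_zero] at hG₁
    have hN₂Q : (N₂ : ℚ) ≠ 0 := by exact_mod_cast hN₂.ne'
    exact mul_ne_zero (C_ne_zero.mpr hN₂Q) hG0 hG₁.symm
  have hG₁deg : (g * H₁).natDegree ≤ φ.natDegree + 1 := by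
    rw [← natDegree_map_eq_of_injective hinj, hG₁]
    exact (natDegree_C_mul_le _ _).trans hGdeg
  have hAdeg : A.natDegree = φ.natDegree := by
    rw [← natDegree_map_eq_of_injective hinj, hA, natDegree_C_mul hBQ]
  have hA0 : A ≠ 0 := ne_zero_of_natDegree_gt (hAdeg.symm ▸ hφ)
  have hAB0 : A - C (B : ℤ) ≠ 0 := by
    refine ne_zero_of_natDegree_gt (n := 0) ?_
    rw [natDegree_sub_C, hAdeg]; exact hφ
  have hid : C ((N₂ : ℤ) ^ k) * (A * (A - C (B : ℤ)) * U₁) =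
      C ((B : ℤ) ^ 2 * N₃) * (g * H₁) ^ k := by
    apply Polynomial.map_injective _ hinj
    simp only [Polynomial.map_mul, Polynomial.map_sub, Polynomial.map_C, Polynomial.map_pow, hA,
      hU₁] at hG₁ ⊢
    rw [hG₁, mul_pow, hU]
    simp only [map_pow, map_mul, eq_intCast, Int.cast_natCast]
    ring
  set n := φ.natDegree with hn
  have hnR : (0 : ℝ) < n := by exact_mod_cast hφ
  have hε : (0 : ℝ) < 1 / (4 * n) := by positivity
  obtain ⟨K₁, hK₁, habcK⟩ := habc.exists_int_bound hε B hB
  obtain ⟨K₂, hK₂, hupper⟩ := eval_abs_le_mul_pow (g * H₁) hG₁deg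
  obtain ⟨K₃, hK₃, hlower⟩ := mul_pow_le_eval_abs A hA0
  have hne : ∀ p : ℤ[X], p ≠ 0 → ∀ᶠ t : ℕ in Filter.atTop, p.eval (t : ℤ) ≠ 0 := by
    intro p hp
    rw [← Nat.cofinite_eq_atTop]
    rw [Filter.eventually_cofinite]
    refine ((finite_setOfPred_isRoot hp).preimage Nat.cast_injective.injOn).subset fun t ht => ?_
    exact not_not.mp ht
  set N : ℕ := B ^ 2 * N₃ with hN
  have hNpos : 0 < N := by positivity
  set e : ℝ := 1 + 1 / (4 * n) with he
  have hepos : 0 < e := by positivity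
  refine ⟨N * K₂ / (K₃ / K₁) ^ e⁻¹, by positivity, ?_⟩
  filter_upwards [hupper, hlower, hne _ hG₁0, hne _ hA0, hne _ hAB0, Filter.eventually_ge_atTop 1]
    with t hup hlow hG1t hAt hABt ht m hm
  have htR : (1 : ℝ) ≤ t := by exact_mod_cast ht
  have ht0 : (0 : ℝ) < t := by positivity
  have hABt' : A.eval (t : ℤ) ≠ B := by
    intro h; apply hABt; rw [eval_sub, h, eval_C, sub_self]
  set a := A.eval (t : ℤ) with ha
  set γ := ((g * H₁).eval (t : ℤ)).natAbs with hγ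
  have hγ0 : γ ≠ 0 := Int.natAbs_ne_zero.mpr hG1t
  have hdvd : (a * (a - B)).natAbs ∣ (N * γ) ^ (k + 1) := by
    have h1 := congrArg (eval (t : ℤ)) hid
    simp only [eval_mul, eval_C, eval_pow, eval_sub, ← ha] at h1
    have h2 : (a * (a - B)) ∣ (N : ℤ) * ((g * H₁).eval (t : ℤ)) ^ k := by
      refine ⟨N₂ ^ k * U₁.eval (t : ℤ), ?_⟩
      rw [hN, eval_mul]; push_cast
      linear_combination -h1
    have h3 := Int.natAbs_dvd_natAbs.mpr h2
    rw [Int.natAbs_mul (N : ℤ), Int.natAbs_pow, Int.natAbs_natCast, ← hγ] at h3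
    refine h3.trans ?_
    rw [mul_pow]
    exact mul_dvd_mul (dvd_pow_self _ k.succ_ne_zero) (pow_dvd_pow _ (Nat.le_succ k))
  have hRad : m * Rad (a * (a - B)).natAbs ≤ N * γ := by
    have hmγ : m ^ 2 ∣ γ := by
      have h1 : (m : ℤ) ^ 2 ∣ (g * H₁).eval (t : ℤ) := by
        rw [eval_mul]; exact hm.mul_right _
      have := Int.natAbs_dvd_natAbs.mpr h1
      rwa [Int.natAbs_pow, Int.natAbs_natCast] at this
    calc m * Rad (a * (a - B)).natAbs ≤ m * (N * Rad γ) := by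
          refine Nat.mul_le_mul_left _ ?_
          calc Rad (a * (a - B)).natAbs ≤ Rad ((N * γ) ^ (k + 1)) :=
                Rad_le_of_dvd hdvd (by positivity)
            _ = Rad (N * γ) := Rad_pow _ k.succ_ne_zero
            _ ≤ Rad N * Rad γ := Rad_mul_le hNpos.ne' hγ0
            _ ≤ _ := Nat.mul_le_mul_right _ (Rad_le_self hNpos.ne')
      _ = N * (m * Rad γ) := by ring
      _ ≤ N * γ := Nat.mul_le_mul_left _ (mul_Rad_le hmγ hγ0)
  set R := Rad (a * (a - B)).natAbs with hR
  have hRpos : (0 : ℝ) < R := by exact_mod_cast Rad_pos _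
  have h1 : K₃ / K₁ * (t : ℝ) ^ n ≤ (R : ℝ) ^ e := by
    rw [div_mul_eq_mul_div, div_le_iff₀' hK₁]
    rw [hAdeg] at hlow
    exact hlow.trans (habcK a hAt hABt')
  have h2 : (K₃ / K₁) ^ e⁻¹ * (t : ℝ) ^ ((n : ℝ) * e⁻¹) ≤ R := by
    have h3 := Real.rpow_le_rpow (by positivity) h1 (inv_pos.mpr hepos).le
    rwa [Real.mul_rpow (by positivity) (by positivity), ← Real.rpow_mul hRpos.le,
      mul_inv_cancel₀ hepos.ne', Real.rpow_one, ← Real.rpow_natCast, ← Real.rpow_mul ht0.le] at h3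
  have h4 : (t : ℝ) ^ ((n : ℝ) - 1 / 4) ≤ (t : ℝ) ^ ((n : ℝ) * e⁻¹) := by
    refine Real.rpow_le_rpow_of_exponent_le htR ?_
    rw [← div_eq_mul_inv, le_div_iff₀ hepos, he]
    have : ((n : ℝ) - 1 / 4) * (1 + 1 / (4 * n)) = n - 1 / (16 * n) := by field_simp; ring
    rw [this]
    have : (0 : ℝ) < 1 / (16 * n) := by positivity
    linarith
  have h5 : (m : ℝ) * R ≤ N * (K₂ * (t : ℝ) ^ (n + 1)) := by
    have h6 : (γ : ℝ) ≤ K₂ * (t : ℝ) ^ (n + 1) := by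
      rw [hγ, Nat.cast_natAbs, Int.cast_abs]; exact hup
    calc (m : ℝ) * R ≤ N * γ := by exact_mod_cast hRad
      _ ≤ _ := by gcongr
  have h7 : (t : ℝ) ^ (n + 1) = (t : ℝ) ^ ((n : ℝ) - 1 / 4) * (t : ℝ) ^ (5 / 4 : ℝ) := by
    rw [← Real.rpow_add ht0, ← Real.rpow_natCast]
    congr 1; push_cast; ring
  have hκ : (0 : ℝ) < (K₃ / K₁) ^ e⁻¹ := by positivity
  have hτ : (0 : ℝ) < (t : ℝ) ^ ((n : ℝ) - 1 / 4) := by positivity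
  rw [div_mul_eq_mul_div, le_div_iff₀ hκ]
  refine le_of_mul_le_mul_right ?_ hτ
  calc (m : ℝ) * (K₃ / K₁) ^ e⁻¹ * (t : ℝ) ^ ((n : ℝ) - 1 / 4)
      = m * ((K₃ / K₁) ^ e⁻¹ * (t : ℝ) ^ ((n : ℝ) - 1 / 4)) := by ring
    _ ≤ m * R := by
        refine mul_le_mul_of_nonneg_left (le_trans ?_ h2) (by positivity)
        exact mul_le_mul_of_nonneg_left h4 hκ.le
    _ ≤ _ := h5
    _ = _ := by rw [h7]; ring

lemma exists_bezout (f : ℤ[X]) (hf : (f.map (Int.castRingHom ℚ)).Separable) :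
    ∃ Δ : ℕ, 0 < Δ ∧ ∃ U V : ℤ[X], U * f + V * derivative f = C (Δ : ℤ) := by
  obtain ⟨a, b, hab⟩ := hf
  obtain ⟨M, hM, u, hu⟩ := exists_int_multiple a
  obtain ⟨N, hN, v, hv⟩ := exists_int_multiple b
  refine ⟨M * N, by positivity, C (N : ℤ) * u, C (M : ℤ) * v, ?_⟩
  apply map_injective (Int.castRingHom ℚ) (RingHom.injective_int _)
  simp only [Polynomial.map_add, Polynomial.map_mul, hu, hv, map_C, ← derivative_map] at hab ⊢
  push_cast
  simp only [eq_intCast, Int.cast_natCast, map_mul]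
  linear_combination (C (M : ℚ) * C (N : ℚ)) * hab

lemma exists_separable_shift (f : ℤ[X]) (hf : (f.map (Int.castRingHom ℚ)).Separable)
    {L : ℕ} (hL : 0 < L) :
    ∃ h : ℕ, 0 < h ∧ L ∣ h ∧
      ((f * f.comp (X + C (h : ℤ))).map (Int.castRingHom ℚ)).Separable := by
  classical
  set F := f.map (Int.castRingHom ℚ) with hF
  have hF0 : F ≠ 0 := hf.ne_zero
  set R := (F.aroots ℂ).toFinset
  obtain ⟨z, ⟨t, rfl⟩, hz⟩ := (Set.infinite_range_of_injective
    (f := fun t : ℕ => ((L * (t + 1) : ℕ) : ℂ)) (fun a b hab => by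
      have : L * (a + 1) = L * (b + 1) := Nat.cast_injective (R := ℂ) hab
      simpa using Nat.eq_of_mul_eq_mul_left hL this)).exists_notMem_finset
    ((R ×ˢ R).image fun ab => ab.1 - ab.2)
  refine ⟨L * (t + 1), by positivity, dvd_mul_right _ _, ?_⟩
  set h := L * (t + 1)
  have hcomp : (f.comp (X + C (h : ℤ))).map (Int.castRingHom ℚ) = F.comp (X + C (h : ℚ)) := by
    rw [map_comp]; simp [hF]
  rw [Polynomial.map_mul, hcomp]
  have hder : derivative (F.comp (X + C (h : ℚ))) = (derivative F).comp (X + C (h : ℚ)) := by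
    rw [derivative_comp]; simp
  refine hf.mul ?_ ?_
  · rw [separable_def, hder]
    exact IsCoprime.map hf (compRingHom (X + C (h : ℚ)))
  · rw [isCoprime_iff_aeval_ne_zero_of_isAlgClosed ℚ ℂ]
    intro a
    by_contra! hcon
    apply hz
    rw [aeval_comp] at hcon
    refine Finset.mem_image.mpr ⟨(a + h, a), ?_, by simp [h]⟩
    simp only [Finset.mem_product, R, Multiset.mem_toFinset, mem_aroots]
    exact ⟨⟨hF0, by simpa using hcon.2⟩, hF0, hcon.1⟩

lemma card_Ioc_modEq_le (X v : ℕ) {r : ℕ} (hr : 0 < r) :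
    ((Finset.Ioc X (2 * X)).filter (· ≡ v [MOD r])).card ≤ X / r + 1 := by
  have h := Nat.Ioc_filter_modEq_card X (2 * X) hr v
  set c := ((Finset.Ioc X (2 * X)).filter (· ≡ v [MOD r])).card
  rcases Nat.eq_zero_or_pos c with h0 | hc
  · rw [h0]; exact Nat.zero_le _
  rw [max_eq_left (by by_contra! h'; rw [max_eq_right h'.le] at h; omega)] at h
  have h1 := Int.floor_le (((2 * X : ℕ) - v : ℚ) / r)
  have h2 := Int.lt_floor_add_one ((X - v : ℚ) / r)
  have hr' : (0 : ℚ) < r := by exact_mod_cast hr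
  have h3 : (c : ℚ) = (⌊((2 * X : ℕ) - v : ℚ) / r⌋ : ℤ) - (⌊(X - v : ℚ) / r⌋ : ℤ) := by
    exact_mod_cast h
  have h4 : (c : ℚ) - 1 < X / r := by
    have : ((2 * X : ℕ) - v : ℚ) / r - (X - v : ℚ) / r = X / r := by push_cast; ring
    linarith
  have h5 : (c - 1) * r ≤ X := by
    rw [lt_div_iff₀ hr'] at h4
    have : (((c - 1) * r : ℕ) : ℚ) < X := by push_cast [Nat.cast_sub hc]; exact h4
    exact le_of_lt (by exact_mod_cast this)
  have := (Nat.le_div_iff_mul_le hr).mpr h5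
  omega

lemma map_zmod_ne_zero {f U V : ℤ[X]} {Δ : ℕ}
    (hΔ : U * f + V * derivative f = C (Δ : ℤ)) {q : ℕ} (hq : ¬ q ∣ Δ) :
    f.map (Int.castRingHom (ZMod q)) ≠ 0 := by
  intro h0
  have := congrArg (Polynomial.map (Int.castRingHom (ZMod q))) hΔ
  rw [Polynomial.map_add, Polynomial.map_mul, Polynomial.map_mul, ← derivative_map, h0, map_C] at this
  rw [mul_zero, derivative_zero, mul_zero, add_zero, eq_comm, C_eq_zero, eq_intCast,
    Int.cast_natCast, ZMod.natCast_eq_zero_iff] at this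
  exact hq this

lemma not_dvd_derivative_eval {f U V : ℤ[X]} {Δ : ℕ}
    (hΔ : U * f + V * derivative f = C (Δ : ℤ)) {q : ℕ} (hq : ¬ q ∣ Δ) {a : ℤ}
    (ha : (q : ℤ) ∣ f.eval a) : ¬ (q : ℤ) ∣ (derivative f).eval a := by
  intro h
  have := congrArg (Polynomial.eval a) hΔ
  simp only [eval_add, eval_mul, eval_C] at this
  exact hq (Int.natCast_dvd_natCast.mp (this ▸ dvd_add (ha.mul_left _) (h.mul_left _)))

lemma card_square_dvd_le {f U V : ℤ[X]} {Δ : ℕ}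
    (hΔ : U * f + V * derivative f = C (Δ : ℤ)) {q : ℕ} (hq : q.Prime) (hqΔ : ¬ q ∣ Δ)
    {L : ℕ} (hqL : ¬ q ∣ L) (n X : ℕ) :
    ((Finset.Ioc X (2 * X)).filter
      fun t : ℕ => (q : ℤ) ^ 2 ∣ f.eval ((n + L * t : ℕ) : ℤ)).card ≤
      (X / q ^ 2 + 1) * f.natDegree := by
  classical
  have := Fact.mk hq
  set F := f.map (Int.castRingHom (ZMod q)) with hF
  have hF0 : F ≠ 0 := map_zmod_ne_zero hΔ hqΔ
  have hdvd : ∀ t : ℕ, F.IsRoot ((n + L * t : ℕ) : ZMod q) ↔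
      (q : ℤ) ∣ f.eval ((n + L * t : ℕ) : ℤ) := fun t => by
    rw [IsRoot, hF, ← ZMod.intCast_zmod_eq_zero_iff_dvd _ q]
    have := eval_intCast_map (Int.castRingHom (ZMod q)) f ((n + L * t : ℕ) : ℤ)
    rw [Int.cast_natCast] at this
    rw [this]; simp
  refine (Finset.card_le_mul_card_image_of_maps_to (t := F.roots.toFinset)
    (f := fun t : ℕ => ((n + L * t : ℕ) : ZMod q)) ?_ (X / q ^ 2 + 1) ?_).trans ?_
  · intro t ht
    rw [Multiset.mem_toFinset, mem_roots hF0, hdvd]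
    exact (dvd_pow_self _ two_ne_zero).trans (Finset.mem_filter.mp ht).2
  · intro b _
    rcases Finset.eq_empty_or_nonempty (Finset.filter
      (fun t : ℕ => ((n + L * t : ℕ) : ZMod q) = b) ((Finset.Ioc X (2 * X)).filter
      fun t : ℕ => (q : ℤ) ^ 2 ∣ f.eval ((n + L * t : ℕ) : ℤ))) with he | ⟨s, hs⟩
    · rw [he]; simp
    refine (Finset.card_le_card ?_).trans (card_Ioc_modEq_le X s (pow_pos hq.pos 2))
    intro t ht
    simp only [Finset.mem_filter] at ht hs ⊢
    refine ⟨ht.1.1, ?_⟩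
    obtain ⟨k, hk⟩ := binomExpansion f ((n + L * s : ℕ) : ℤ) ((L : ℤ) * (t - s))
    have hx : ((n + L * s : ℕ) : ℤ) + (L : ℤ) * (t - s) = ((n + L * t : ℕ) : ℤ) := by
      push_cast; ring
    rw [hx] at hk
    have hqy : (q : ℤ) ∣ (L : ℤ) * (t - s) := by
      have : ((n + L * t : ℕ) : ZMod q) = ((n + L * s : ℕ) : ZMod q) := ht.2.trans hs.2.symm
      rw [← ZMod.intCast_zmod_eq_zero_iff_dvd]
      push_cast at this ⊢
      linear_combination this
    have hs' : (q : ℤ) ∣ f.eval ((n + L * s : ℕ) : ℤ) :=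
      (dvd_pow_self _ two_ne_zero).trans hs.1.2
    have h1 : (q : ℤ) ^ 2 ∣ (derivative f).eval ((n + L * s : ℕ) : ℤ) * ((L : ℤ) * (t - s)) := by
      have := dvd_sub (dvd_sub ht.1.2 hs.1.2) ((pow_dvd_pow_of_dvd hqy 2).mul_left k)
      have e : (derivative f).eval ((n + L * s : ℕ) : ℤ) * ((L : ℤ) * (t - s)) =
          f.eval ((n + L * t : ℕ) : ℤ) - f.eval ((n + L * s : ℕ) : ℤ) -
            k * ((L : ℤ) * (t - s)) ^ 2 := by linear_combination -hk
      rwa [e]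
    have hqp : Prime (q : ℤ) := Nat.prime_iff_prime_int.mp hq
    have c1 : IsCoprime ((q : ℤ) ^ 2) ((derivative f).eval ((n + L * s : ℕ) : ℤ)) :=
      ((hqp.coprime_iff_not_dvd).mpr (not_dvd_derivative_eval hΔ hqΔ hs')).pow_left
    have c2 : IsCoprime ((q : ℤ) ^ 2) (L : ℤ) :=
      ((hqp.coprime_iff_not_dvd).mpr (by exact_mod_cast hqL)).pow_left
    have h2 := c2.dvd_of_dvd_mul_left (c1.dvd_of_dvd_mul_left h1)
    exact ((Nat.modEq_iff_dvd).mpr (by push_cast; exact h2)).symm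
  · exact Nat.mul_le_mul_left _ ((Multiset.toFinset_card_le _).trans
      ((card_roots' _).trans natDegree_map_le))

open Classical in
lemma card_medium_square_dvd_le {f U V : ℤ[X]} {Δ : ℕ} (hΔ0 : 0 < Δ)
    (hΔ : U * f + V * derivative f = C (Δ : ℤ)) (hf : 0 < f.natDegree) {Q : ℕ} (hQΔ : Δ ≤ Q)
    (hQ : 8 * f.natDegree ≤ Q) {L : ℕ} (hL : ∀ q : ℕ, q.Prime → q ≤ Q → q ∣ L) (n X : ℕ) :
    4 * ((Finset.Ioc X (2 * X)).filter fun t : ℕ => ∃ q : ℕ, q.Prime ∧ ¬ q ∣ L ∧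
      q * (8 * f.natDegree) ≤ X ∧ (q : ℤ) ^ 2 ∣ f.eval ((n + L * t : ℕ) : ℤ)).card ≤ X := by
  set D := f.natDegree
  set Y := X / (8 * D) with hY
  set P := (Finset.Ioc Q Y).filter fun q => q.Prime ∧ ¬ q ∣ L
  have hsub : ((Finset.Ioc X (2 * X)).filter fun t : ℕ => ∃ q : ℕ, q.Prime ∧ ¬ q ∣ L ∧
      q * (8 * D) ≤ X ∧ (q : ℤ) ^ 2 ∣ f.eval ((n + L * t : ℕ) : ℤ)) ⊆
      P.biUnion fun q => (Finset.Ioc X (2 * X)).filter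
        fun t : ℕ => (q : ℤ) ^ 2 ∣ f.eval ((n + L * t : ℕ) : ℤ) := by
    intro t ht
    obtain ⟨htX, q, hq, hqL, hqX, hqf⟩ := Finset.mem_filter.mp ht
    refine Finset.mem_biUnion.mpr ⟨q, ?_, Finset.mem_filter.mpr ⟨htX, hqf⟩⟩
    refine Finset.mem_filter.mpr ⟨Finset.mem_Ioc.mpr ⟨?_, ?_⟩, hq, hqL⟩
    · by_contra! h
      exact hqL (hL q hq h)
    · exact (Nat.le_div_iff_mul_le (by positivity)).mpr hqX
  have hcard := (Finset.card_le_card hsub).trans Finset.card_biUnion_le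
  have hbound : ∀ q ∈ P, (((Finset.Ioc X (2 * X)).filter
      fun t : ℕ => (q : ℤ) ^ 2 ∣ f.eval ((n + L * t : ℕ) : ℤ)).card : ℝ) ≤
      D * (X * ((q : ℝ) ^ 2)⁻¹ + 1) := by
    intro q hq
    obtain ⟨hqI, hqp, hqL⟩ := Finset.mem_filter.mp hq
    have hqQ := (Finset.mem_Ioc.mp hqI).1
    have h1 := card_square_dvd_le hΔ hqp
      (fun h => by have := Nat.le_of_dvd hΔ0 h; omega) hqL n X
    have h2 : ((X / q ^ 2 : ℕ) : ℝ) ≤ X * ((q : ℝ) ^ 2)⁻¹ := by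
      have := Nat.cast_div_le (α := ℝ) (m := X) (n := q ^ 2)
      rwa [div_eq_mul_inv, Nat.cast_pow] at this
    calc _ ≤ (((X / q ^ 2 + 1) * D : ℕ) : ℝ) := by exact_mod_cast h1
      _ = D * (((X / q ^ 2 : ℕ) : ℝ) + 1) := by push_cast; ring
      _ ≤ _ := by gcongr
  rcases Nat.lt_or_ge Y Q with hYQ | hQY
  · have hP : P = ∅ := by
      refine Finset.filter_eq_empty_iff.mpr fun q hq => ?_
      have := Finset.mem_Ioc.mp hq
      omega
    rw [hP, Finset.sum_empty] at hcard
    omega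
  have hQ0 : (0 : ℝ) < Q := by
    have : 0 < Q := by omega
    exact_mod_cast this
  have hD0 : (0 : ℝ) < D := by exact_mod_cast hf
  have hQD : (8 * D : ℝ) ≤ Q := by exact_mod_cast hQ
  have hYX : (Y : ℝ) * (8 * D) ≤ X := by exact_mod_cast Nat.div_mul_le_self X (8 * D)
  have hreal : (((Finset.Ioc X (2 * X)).filter fun t : ℕ => ∃ q : ℕ, q.Prime ∧ ¬ q ∣ L ∧
      q * (8 * D) ≤ X ∧ (q : ℤ) ^ 2 ∣ f.eval ((n + L * t : ℕ) : ℤ)).card : ℝ) ≤ X / 4 := by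
    calc _ ≤ ∑ q ∈ P, (((Finset.Ioc X (2 * X)).filter
          fun t : ℕ => (q : ℤ) ^ 2 ∣ f.eval ((n + L * t : ℕ) : ℤ)).card : ℝ) := by
          exact_mod_cast hcard
      _ ≤ ∑ q ∈ P, (D * (X * ((q : ℝ) ^ 2)⁻¹ + 1) : ℝ) := Finset.sum_le_sum hbound
      _ ≤ ∑ q ∈ Finset.Ioc Q Y, (D * (X * ((q : ℝ) ^ 2)⁻¹ + 1) : ℝ) :=
          Finset.sum_le_sum_of_subset_of_nonneg (Finset.filter_subset _ _)
            fun _ _ _ => by positivity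
      _ = D * X * ∑ q ∈ Finset.Ioc Q Y, ((q : ℝ) ^ 2)⁻¹ + D * ((Y - Q : ℕ) : ℝ) := by
          rw [← Finset.mul_sum, Finset.sum_add_distrib, ← Finset.mul_sum]
          simp; ring
      _ ≤ D * X * (Q : ℝ)⁻¹ + D * Y := by
          have h1 := sum_Ioc_inv_sq_le_sub (α := ℝ) (k := Q) (n := Y) (by omega) hQY
          have h2 : (0 : ℝ) ≤ (Y : ℝ)⁻¹ := by positivity
          gcongr
          · linarith
          · omega
      _ ≤ X / 8 + X / 8 := by
          gcongr
          · rw [← div_eq_mul_inv, div_le_div_iff₀ hQ0 (by norm_num)]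
            nlinarith [Nat.cast_nonneg (α := ℝ) X]
          · linarith
      _ = X / 4 := by ring
  have : (4 * (((Finset.Ioc X (2 * X)).filter fun t : ℕ => ∃ q : ℕ, q.Prime ∧ ¬ q ∣ L ∧
      q * (8 * D) ≤ X ∧ (q : ℤ) ^ 2 ∣ f.eval ((n + L * t : ℕ) : ℤ)).card : ℕ) : ℝ) ≤ X := by
    linarith
  exact_mod_cast this

lemma AbcConjecture.exists_squarefree_outside (habc : AbcConjecture) {f U V : ℤ[X]} {Δ : ℕ}
    (hsep : (f.map (Int.castRingHom ℚ)).Separable) (hΔ0 : 0 < Δ)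
    (hΔ : U * f + V * derivative f = C (Δ : ℤ)) (hf : 0 < f.natDegree) {Q : ℕ} (hQΔ : Δ ≤ Q)
    (hQ : 8 * f.natDegree ≤ Q) {L : ℕ} (hL0 : 0 < L)
    (hL : ∀ q : ℕ, q.Prime → q ≤ Q → q ∣ L) (n₁ T : ℕ) :
    ∃ n : ℕ, T ≤ n ∧ n ≡ n₁ [MOD L] ∧
      ∀ q : ℕ, q.Prime → ¬ q ∣ L → ¬ (q : ℤ) ^ 2 ∣ f.eval (n : ℤ) := by
  classical
  obtain ⟨h, hh0, hLh, hg⟩ := exists_separable_shift f hsep hL0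
  obtain ⟨K, hK, hev⟩ := habc.square_divisor_bound _ hg
  obtain ⟨T₀, hT₀⟩ := Filter.eventually_atTop.mp hev
  set D := f.natDegree
  have hD0 : (0 : ℝ) < D := by exact_mod_cast hf
  have hlim := (tendsto_rpow_atTop (show (0 : ℝ) < 3 / 4 by norm_num)).comp
    (tendsto_natCast_atTop_atTop (R := ℝ))
  obtain ⟨x, hx, hxT, hxT₀, hx1⟩ := ((hlim.eventually_ge_atTop
    (K * ((n₁ + 2 * L : ℕ) : ℝ) ^ (5 / 4 : ℝ) * (8 * D) ^ 2)).and
    ((Filter.eventually_ge_atTop T).and ((Filter.eventually_ge_atTop T₀).and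
      (Filter.eventually_ge_atTop 1)))).exists
  have hmed := card_medium_square_dvd_le hΔ0 hΔ hf hQΔ hQ hL
  set B : ℕ → Finset ℕ := fun n => (Finset.Ioc x (2 * x)).filter fun t : ℕ => ∃ q : ℕ, q.Prime ∧
    ¬ q ∣ L ∧ q * (8 * D) ≤ x ∧ (q : ℤ) ^ 2 ∣ f.eval ((n + L * t : ℕ) : ℤ) with hB
  have hb1 : 4 * (B n₁).card ≤ x := hmed n₁ x
  have hb2 : 4 * (B (n₁ + h)).card ≤ x := hmed (n₁ + h) x
  have hcard : (B n₁ ∪ B (n₁ + h)).card < (Finset.Ioc x (2 * x)).card := by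
    have := Finset.card_union_le (B n₁) (B (n₁ + h))
    rw [Nat.card_Ioc]
    omega
  obtain ⟨t, ht, htB⟩ := Finset.exists_mem_notMem_of_card_lt_card hcard
  rw [Finset.mem_union, not_or] at htB
  have htx := Finset.mem_Ioc.mp ht
  have hLt : t ≤ L * t := Nat.le_mul_of_pos_left t hL0
  by_contra! hcon
  obtain ⟨q₁, hq₁, hq₁L, hq₁f⟩ := hcon (n₁ + L * t) (by omega) (by simp [Nat.ModEq])
  obtain ⟨q₂, hq₂, hq₂L, hq₂f⟩ := hcon (n₁ + h + L * t) (by omega) (by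
    obtain ⟨j, rfl⟩ := hLh
    simp [Nat.ModEq])
  have large : ∀ n q : ℕ, t ∉ B n → q.Prime → ¬ q ∣ L →
      (q : ℤ) ^ 2 ∣ f.eval ((n + L * t : ℕ) : ℤ) → (x : ℝ) < q * (8 * D) := by
    intro n q hn hq hqL hqf
    by_contra! hle
    exact hn (Finset.mem_filter.mpr ⟨ht, q, hq, hqL, by exact_mod_cast hle, hqf⟩)
  have hl1 := large _ _ htB.1 hq₁ hq₁L hq₁f
  have hl2 := large _ _ htB.2 hq₂ hq₂L hq₂f
  have hm := hT₀ (n₁ + L * t) (by omega) (q₁ * q₂) (by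
    have e : ((n₁ + L * t : ℕ) : ℤ) + (h : ℤ) = ((n₁ + h + L * t : ℕ) : ℤ) := by
      push_cast; ring
    rw [eval_mul, eval_comp, eval_add, eval_X, eval_C, e, Nat.cast_mul, mul_pow]
    exact mul_dvd_mul hq₁f hq₂f)
  have hx0 : (0 : ℝ) < x := by exact_mod_cast hx1
  have hle : ((n₁ + L * t : ℕ) : ℝ) ≤ ((n₁ + 2 * L : ℕ) : ℝ) * x := by
    have : n₁ + L * t ≤ (n₁ + 2 * L) * x := by nlinarith [htx.2, Nat.le_mul_of_pos_right n₁ hx1]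
    exact_mod_cast this
  have h1 : ((q₁ * q₂ : ℕ) : ℝ) ≤
      K * (((n₁ + 2 * L : ℕ) : ℝ) ^ (5 / 4 : ℝ) * (x : ℝ) ^ (5 / 4 : ℝ)) := by
    refine hm.trans (mul_le_mul_of_nonneg_left ?_ hK.le)
    rw [← Real.mul_rpow (by positivity) (by positivity)]
    exact Real.rpow_le_rpow (by positivity) hle (by norm_num)
  have h2 : (x : ℝ) ^ 2 < ((q₁ * q₂ : ℕ) : ℝ) * (8 * D) ^ 2 := by
    push_cast
    calc (x : ℝ) ^ 2 = x * x := sq _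
      _ < (q₁ * (8 * D)) * (q₂ * (8 * D)) := mul_lt_mul'' hl1 hl2 hx0.le hx0.le
      _ = _ := by ring
  have h3 : (x : ℝ) ^ 2 = (x : ℝ) ^ (3 / 4 : ℝ) * (x : ℝ) ^ (5 / 4 : ℝ) := by
    rw [← Real.rpow_add hx0, ← Real.rpow_natCast]; norm_num
  have h4 : (0 : ℝ) < (x : ℝ) ^ (5 / 4 : ℝ) := by positivity
  have h5 : K * ((n₁ + 2 * L : ℕ) : ℝ) ^ (5 / 4 : ℝ) * (8 * D) ^ 2 ≤ (x : ℝ) ^ (3 / 4 : ℝ) := hx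
  have h6 := mul_le_mul_of_nonneg_right h5 h4.le
  have h7 := mul_le_mul_of_nonneg_right h1 (show (0 : ℝ) ≤ (8 * D) ^ 2 by positivity)
  rw [h3] at h2
  linarith

lemma X_sub_C_pow_dvd_of_iterate {p : ℕ} [Fact p.Prime] {f : (ZMod p)[X]} {x : ZMod p}
    (hx : f.eval x ≠ 0) {M : ℕ} (hM : M ≤ p) (P : (ZMod p)[X])
    (hP : ∀ i < M, ((fun R => f * derivative R)^[i] P).eval x = 0) : (X - C x) ^ M ∣ P := by
  induction M generalizing P with
  | zero => simp
  | succ M ih =>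
    obtain ⟨h, rfl⟩ := ih (by omega) P fun i hi => hP i (by omega)
    rw [pow_succ]
    refine mul_dvd_mul_left _ ?_
    rcases Nat.eq_zero_or_pos M with rfl | hM0
    · have := hP 0 (by omega)
      rw [dvd_iff_isRoot]
      simpa using this
    have h1 : (X - C x) ^ M ∣ f * derivative ((X - C x) ^ M * h) :=
      ih (by omega) _ fun i hi => hP (i + 1) (by omega)
    have hcop : IsCoprime ((X - C x) ^ M) f := by
      refine IsCoprime.pow_left (((irreducible_X_sub_C x).coprime_iff_not_dvd).mpr ?_)
      rwa [dvd_iff_isRoot]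
    have h2 := hcop.dvd_of_dvd_mul_left h1
    rw [derivative_mul, derivative_X_sub_C_pow] at h2
    have h3 := (dvd_add_left (dvd_mul_right _ _)).mp h2
    obtain ⟨m, rfl⟩ : ∃ m, M = m + 1 := ⟨M - 1, by omega⟩
    have h4 : (X - C x) ∣ C ((m + 1 : ℕ) : ZMod p) * h := by
      refine (mul_dvd_mul_iff_left (pow_ne_zero m (X_sub_C_ne_zero x))).mp ?_
      rw [← pow_succ]
      convert h3 using 1
      simp only [Nat.add_sub_cancel]; ring
    have h5 : ((m + 1 : ℕ) : ZMod p) ≠ 0 := by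
      rw [Ne, ZMod.natCast_eq_zero_iff]
      exact fun hd => by have := Nat.le_of_dvd (by omega) hd; omega
    rw [dvd_iff_isRoot] at h4 ⊢
    simp only [IsRoot.def, eval_mul, eval_C, mul_eq_zero, h5, false_or] at h4
    exact h4

lemma eq_zero_of_pow_mul_eq {K : Type*} [Field K] {f a b : K[X]} (hf : Squarefree f)
    (hdeg : 0 < f.natDegree) {r : ℕ} (hr : 2 ≤ r) {u : K} (hu : u ≠ 0)
    (h : a ^ r * f = C u * b ^ r) : a = 0 ∧ b = 0 := by
  have hf0 : f ≠ 0 := by rintro rfl; simp at hdeg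
  rcases eq_or_ne a 0 with rfl | ha
  · refine ⟨rfl, ?_⟩
    rw [zero_pow (by omega), zero_mul, eq_comm, mul_eq_zero] at h
    exact eq_zero_of_pow_eq_zero (h.resolve_left (C_ne_zero.mpr hu))
  exfalso
  have hun : IsUnit (C u) := isUnit_C.mpr hu.isUnit
  have h1 : a ^ r ∣ b ^ r := (hun.dvd_mul_left).mp (h ▸ dvd_mul_right _ _)
  obtain ⟨e, rfl⟩ := (UniqueFactorizationMonoid.pow_dvd_pow_iff_dvd (by omega)).mp h1
  have h2 : f = C u * e ^ r :=
    mul_left_cancel₀ (pow_ne_zero r ha) (by rw [h]; ring)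
  have h3 : IsUnit e := hf e (h2 ▸ ((sq e ▸ pow_dvd_pow e hr).mul_left _))
  have h4 : IsUnit f := h2 ▸ hun.mul (h3.pow r)
  exact hdeg.ne' (natDegree_eq_zero_of_isUnit h4)

lemma eq_zero_of_X_pow_dvd {p : ℕ} [Fact p.Prime] {f a b : (ZMod p)[X]} (hf : Squarefree f)
    (hdeg : 0 < f.natDegree) (h0 : f.eval 0 ≠ 0) {r s E : ℕ} (hr : 2 ≤ r) (hrs : r * s + 1 = p)
    (ha : a.natDegree ≤ E) (hb : b.natDegree ≤ E) (hE : r * E + f.natDegree < p)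
    (h : X ^ p ∣ a + f ^ s * b) : a = 0 ∧ b = 0 := by
  have hu : (-1) ^ r * f.eval 0 ≠ 0 := mul_ne_zero (pow_ne_zero _ (by simp)) h0
  refine eq_zero_of_pow_mul_eq hf hdeg hr hu (sub_eq_zero.mp ?_)
  have h1 : X ^ p ∣ a ^ r - (-(f ^ s * b)) ^ r := by
    refine dvd_trans ?_ (sub_dvd_pow_sub_pow _ _ r)
    rwa [sub_neg_eq_add]
  have h2 : X ^ p ∣ f ^ p - C (f.eval 0) := by
    have : X ∣ f - C (f.eval 0) := by
      rw [X_dvd_iff]; simp [coeff_zero_eq_eval_zero]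
    have := pow_dvd_pow_of_dvd this p
    rwa [sub_pow_char, ← C_pow, ZMod.pow_card] at this
  have h3 : X ^ p ∣ a ^ r * f - C ((-1) ^ r * f.eval 0) * b ^ r := by
    have := (h1.mul_right f).add (h2.mul_right ((-1) ^ r * b ^ r))
    convert this using 1
    have e : f ^ p = (f ^ s) ^ r * f := by
      rw [← pow_mul, ← pow_succ, mul_comm s r, hrs]
    rw [e, neg_pow (f ^ s * b), mul_pow (f ^ s)]
    simp only [map_mul, map_pow, map_neg, map_one]
    ring
  refine eq_zero_of_dvd_of_natDegree_lt h3 ?_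
  rw [natDegree_X_pow]
  refine lt_of_le_of_lt (natDegree_sub_le_of_le (natDegree_mul_le_of_le
    (natDegree_pow_le_of_le r ha) le_rfl) (natDegree_mul_le_of_le (natDegree_C _).le
    (natDegree_pow_le_of_le r hb))) ?_
  exact max_lt hE (by omega)

lemma eq_zero_of_sum_eq_zero {p : ℕ} [Fact p.Prime] {f : (ZMod p)[X]} (hf : Squarefree f)
    (hdeg : 0 < f.natDegree) (h0 : f.eval 0 ≠ 0) {r s E : ℕ} (hr : 2 ≤ r) (hrs : r * s + 1 = p)
    (hE : r * E + f.natDegree < p) {J : ℕ} (u : ℕ → (ZMod p)[X] × (ZMod p)[X])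
    (hu : ∀ j < J, (u j).1.natDegree ≤ E ∧ (u j).2.natDegree ≤ E)
    (h : ∑ j ∈ Finset.range J, ((u j).1 + f ^ s * (u j).2) * X ^ (p * j) = 0) :
    ∀ j < J, u j = 0 := by
  induction J generalizing u with
  | zero => intro j hj; omega
  | succ J ih =>
    have e : ∑ j ∈ Finset.range (J + 1), ((u j).1 + f ^ s * (u j).2) * X ^ (p * j) =
        X ^ p * (∑ j ∈ Finset.range J, ((u (j + 1)).1 + f ^ s * (u (j + 1)).2) * X ^ (p * j)) +
          ((u 0).1 + f ^ s * (u 0).2) := by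
      rw [Finset.sum_range_succ', Finset.mul_sum]
      congr 1
      · exact Finset.sum_congr rfl fun j _ => by rw [mul_add p j 1, mul_one, pow_add]; ring
      · simp
    rw [e] at h
    have h00 : u 0 = 0 := by
      have := eq_zero_of_X_pow_dvd hf hdeg h0 hr hrs (hu 0 (by omega)).1 (hu 0 (by omega)).2 hE
        ((dvd_add_right (dvd_mul_right _ _)).mp (h ▸ dvd_zero _))
      exact Prod.ext this.1 this.2
    rw [h00] at h
    simp only [Prod.fst_zero, Prod.snd_zero, mul_zero, add_zero, mul_eq_zero] at h
    have hrest := ih (fun j => u (j + 1)) (fun j hj => hu (j + 1) (by omega))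
      (h.resolve_left (pow_ne_zero _ X_ne_zero))
    intro j hj
    cases j with
    | zero => exact h00
    | succ j => exact hrest j (by omega)

lemma iterate_mul_derivative_sum {p : ℕ} [Fact p.Prime] (f : (ZMod p)[X]) (s J i : ℕ)
    (T : (ZMod p)[X] × (ZMod p)[X] → (ZMod p)[X] × (ZMod p)[X])
    (hT : ∀ u, T u = (f * derivative u.1, f * derivative u.2 + C (s : ZMod p) * derivative f * u.2))
    (u : ℕ → (ZMod p)[X] × (ZMod p)[X]) :
    (fun R => f * derivative R)^[i]
        (∑ j ∈ Finset.range J, ((u j).1 + f ^ s * (u j).2) * X ^ (p * j)) =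
      ∑ j ∈ Finset.range J, ((T^[i] (u j)).1 + f ^ s * (T^[i] (u j)).2) * X ^ (p * j) := by
  induction i generalizing u with
  | zero => rfl
  | succ i ih =>
    simp only [Function.iterate_succ_apply]
    rw [← ih fun j => T (u j)]
    congr 1
    rw [derivative_sum, Finset.mul_sum]
    refine Finset.sum_congr rfl fun j _ => ?_
    have h1 : derivative ((X : (ZMod p)[X]) ^ (p * j)) = 0 := by
      rw [derivative_X_pow]; simp
    have h2 : f * derivative (f ^ s) = C (s : ZMod p) * derivative f * f ^ s := by
      cases s with
      | zero => simp
      | succ s => rw [derivative_pow, Nat.add_sub_cancel]; ring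
    rw [hT, derivative_mul, h1, derivative_add, derivative_mul]
    linear_combination (u j).2 * X ^ (p * j) * h2

lemma natDegree_iterate_le {K : Type*} [Field K] {f : K[X]} {D : ℕ} (hf : f.natDegree ≤ D)
    (s : K) (i E : ℕ) (T : K[X] × K[X] → K[X] × K[X])
    (hT : ∀ u, T u = (f * derivative u.1, f * derivative u.2 + C s * derivative f * u.2))
    (u : K[X] × K[X]) (hu : u.1.natDegree ≤ E ∧ u.2.natDegree ≤ E) :
    (T^[i] u).1.natDegree ≤ E + i * D ∧ (T^[i] u).2.natDegree ≤ E + i * D := by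
  induction i generalizing u E with
  | zero => simpa using hu
  | succ i ih =>
    have hd : ∀ a : K[X], a.natDegree ≤ E → (f * derivative a).natDegree ≤ E + D :=
      fun a ha => (natDegree_mul_le_of_le hf ((natDegree_derivative_le a).trans
        ((Nat.sub_le _ _).trans ha))).trans (by omega)
    have := ih (E + D) (T u) (by
      rw [hT]
      refine ⟨hd _ hu.1, natDegree_add_le_of_degree_le (hd _ hu.2) ?_⟩
      refine (natDegree_mul_le_of_le (natDegree_mul_le_of_le (natDegree_C _).le
        ((natDegree_derivative_le f).trans ((Nat.sub_le _ _).trans hf))) hu.2).trans (by omega))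
    rw [Function.iterate_succ_apply]
    have e : E + D + i * D = E + (i + 1) * D := by ring
    rwa [e] at this

lemma exists_auxiliary {K : Type*} [Field K] {f : K[X]} {D : ℕ} (hf : f.natDegree ≤ D)
    (s c : K) {J M E : ℕ} (hE : M * (E + M * D + J + 1) < 2 * J * E)
    (T : K[X] × K[X] → K[X] × K[X])
    (hT : ∀ u, T u = (f * derivative u.1, f * derivative u.2 + C s * derivative f * u.2)) :
    ∃ u : ℕ → K[X] × K[X], (∃ j < J, u j ≠ 0) ∧
      (∀ j < J, (u j).1.natDegree ≤ E ∧ (u j).2.natDegree ≤ E) ∧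
      ∀ i < M, ∑ j ∈ Finset.range J, ((T^[i] (u j)).1 + C c * (T^[i] (u j)).2) * X ^ j = 0 := by
  classical
  let T' : Module.End K (K[X] × K[X]) :=
    { toFun := T
      map_add' := fun u v => by
        simp only [hT, Prod.fst_add, Prod.snd_add, derivative_add, Prod.mk_add_mk, mul_add]
        rw [add_add_add_comm]
      map_smul' := fun a u => by
        simp only [hT, Prod.smul_fst, Prod.smul_snd, derivative_smul, mul_smul_comm,
          RingHom.id_apply, Prod.smul_mk, smul_add] }
  let ev : K[X] × K[X] →ₗ[K] K[X] := LinearMap.fst K _ _ + c • LinearMap.snd K _ _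
  let W := Fin J → degreeLT K E × degreeLT K E
  let inc : degreeLT K E × degreeLT K E →ₗ[K] K[X] × K[X] :=
    LinearMap.prodMap (degreeLT K E).subtype (degreeLT K E).subtype
  let Ψ : ℕ → W →ₗ[K] K[X] := fun i =>
    ∑ j : Fin J, LinearMap.mulRight K (X ^ (j : ℕ)) ∘ₗ ev ∘ₗ (T' ^ i) ∘ₗ inc ∘ₗ LinearMap.proj j
  let B := E + M * D + J + 1
  let Φ : W →ₗ[K] (Fin M × Fin B → K) := LinearMap.pi fun m => lcoeff K m.2 ∘ₗ Ψ m.1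
  have hker : LinearMap.ker Φ ≠ ⊥ := by
    apply LinearMap.ker_ne_bot_of_finrank_lt
    have e : Module.finrank K (degreeLT K E) = E := by
      rw [LinearEquiv.finrank_eq (degreeLTEquiv K E), Module.finrank_fin_fun]
    rw [Module.finrank_fintype_fun_eq_card, Module.finrank_pi_fintype]
    simp only [Module.finrank_prod, e, Fintype.card_prod, Fintype.card_fin, Finset.sum_const,
      Finset.card_univ, smul_eq_mul]
    calc M * B < 2 * J * E := hE
      _ = J * (E + E) := by ring
  obtain ⟨w, hw, hw0⟩ := Submodule.exists_mem_ne_zero_of_ne_bot hker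
  let u : ℕ → K[X] × K[X] := fun j => if h : j < J then inc (w ⟨j, h⟩) else 0
  have hdeg : ∀ j < J, (u j).1.natDegree ≤ E ∧ (u j).2.natDegree ≤ E := by
    intro j hj
    have hlt : ∀ a : degreeLT K E, (a : K[X]).natDegree ≤ E := fun a =>
      natDegree_le_of_degree_le (mem_degreeLT.mp a.2).le
    simp only [u, hj, dif_pos, inc]
    exact ⟨hlt _, hlt _⟩
  refine ⟨u, ?_, hdeg, ?_⟩
  · by_contra! hcon
    apply hw0
    funext j
    have := hcon j j.2
    simp only [u, j.2, dif_pos, inc] at this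
    have h1 := congrArg Prod.fst this
    have h2 := congrArg Prod.snd this
    exact Prod.ext (Subtype.ext h1) (Subtype.ext h2)
  · intro i hi
    set S := ∑ j ∈ Finset.range J, ((T^[i] (u j)).1 + C c * (T^[i] (u j)).2) * X ^ j with hS
    have hSΨ : S = Ψ i w := by
      rw [hS, Finset.sum_range]
      simp only [Ψ, LinearMap.sum_apply]
      refine Finset.sum_congr rfl fun j _ => ?_
      simp only [LinearMap.comp_apply, LinearMap.mulRight_apply, ev,
        LinearMap.add_apply, LinearMap.smul_apply, LinearMap.fst_apply, LinearMap.snd_apply,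
        Module.End.pow_apply, smul_eq_C_mul, u, j.2, dif_pos]
      rfl
    have hSdeg : S.natDegree < B := by
      refine Nat.lt_succ_of_le (natDegree_sum_le_of_forall_le _ _ fun j hj => ?_)
      have hj' := Finset.mem_range.mp hj
      have h1 := natDegree_iterate_le hf s i E T hT (u j) (hdeg j hj')
      have h2 : i * D ≤ M * D := Nat.mul_le_mul_right D hi.le
      refine (natDegree_mul_le_of_le (natDegree_add_le_of_degree_le (h1.1)
        ((natDegree_C_mul_le _ _).trans h1.2)) (natDegree_X_pow_le j)).trans (by omega)
    ext n
    rw [coeff_zero]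
    rcases lt_or_ge n B with hn | hn
    · have := congrFun (LinearMap.mem_ker.mp hw) (⟨i, hi⟩, ⟨n, hn⟩)
      rw [hSΨ]
      exact this
    · exact coeff_eq_zero_of_natDegree_lt (hSdeg.trans_le hn)

lemma exists_pow_ne_of_le {p : ℕ} [Fact p.Prime] {f : (ZMod p)[X]} (hf : Squarefree f)
    (hdeg : 0 < f.natDegree) {D : ℕ} (hD : f.natDegree ≤ D) (h0 : f.eval 0 ≠ 0)
    {r s J M E : ℕ} (hr : 2 ≤ r) (hrs : r * s + 1 = p) (hMp : M ≤ p) (hrE : r * E + D < p)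
    (hE : M * (E + M * D + J + 1) < 2 * J * E) (hlarge : D * s + E + p * J < M * (p - D) + p)
    (c : ZMod p) : ∃ x, f.eval x ≠ 0 ∧ f.eval x ^ s ≠ c := by
  classical
  by_contra! hcon
  let T : (ZMod p)[X] × (ZMod p)[X] → (ZMod p)[X] × (ZMod p)[X] := fun u =>
    (f * derivative u.1, f * derivative u.2 + C (s : ZMod p) * derivative f * u.2)
  obtain ⟨u, ⟨j, hjJ, hj⟩, hu, hS⟩ := exists_auxiliary hD s c hE T fun _ => rfl
  set P := ∑ j ∈ Finset.range J, ((u j).1 + f ^ s * (u j).2) * X ^ (p * j) with hP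
  have hf0 : f ≠ 0 := by rintro rfl; simp at hdeg
  have hP0 : P ≠ 0 := fun h =>
    hj (eq_zero_of_sum_eq_zero hf hdeg h0 hr hrs (by omega) u hu h j hjJ)
  set G := (Finset.univ : Finset (ZMod p)) \ f.roots.toFinset with hG
  have hdvd : ∏ x ∈ G, (X - C x) ^ M ∣ P := by
    refine Finset.prod_dvd_of_coprime ?_ ?_
    · intro x _ y _ hxy
      exact (pairwise_coprime_X_sub_C Function.injective_id hxy).pow
    · intro x hx
      have hx0 : f.eval x ≠ 0 := by
        simpa [hG, hf0] using hx
      refine X_sub_C_pow_dvd_of_iterate hx0 hMp P fun i hi => ?_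
      rw [hP, iterate_mul_derivative_sum f s J i T fun _ => rfl]
      have := congrArg (eval x) (hS i hi)
      rw [eval_zero] at this
      rw [← this, eval_finsetSum, eval_finsetSum]
      refine Finset.sum_congr rfl fun j _ => ?_
      simp only [eval_mul, eval_add, eval_pow, eval_X, eval_C, hcon x hx0]
      rw [pow_mul, ZMod.pow_card]
  have hcard : p - D ≤ G.card := by
    have h1 : (Finset.univ : Finset (ZMod p)).card - f.roots.toFinset.card ≤ G.card :=
      Finset.le_card_sdiff _ _
    rw [Finset.card_univ, ZMod.card] at h1
    have h2 := (Multiset.toFinset_card_le f.roots).trans ((card_roots' f).trans hD)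
    omega
  have hdegP : P.natDegree ≤ D * s + E + p * (J - 1) := by
    refine natDegree_sum_le_of_forall_le _ _ fun j hj => ?_
    have hj' := Finset.mem_range.mp hj
    have hpj : p * j ≤ p * (J - 1) := Nat.mul_le_mul_left p (by omega)
    have hfs : (f ^ s).natDegree ≤ D * s := (natDegree_pow_le_of_le s hD).trans (by rw [mul_comm])
    refine (natDegree_mul_le_of_le (natDegree_add_le_of_degree_le
      ((hu j hj').1.trans (Nat.le_add_left _ _))
      (natDegree_mul_le_of_le hfs (hu j hj').2)) (natDegree_X_pow_le _)).trans (by omega)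
  have h1 := natDegree_le_of_dvd hdvd hP0
  rw [natDegree_prod _ _ fun x _ => pow_ne_zero _ (X_sub_C_ne_zero x)] at h1
  simp only [natDegree_pow, natDegree_X_sub_C, mul_one, Finset.sum_const, smul_eq_mul] at h1
  have h2 : M * (p - D) ≤ G.card * M := by rw [mul_comm]; exact Nat.mul_le_mul_right M hcard
  have h3 : p * (J - 1) + p = p * J := by
    obtain ⟨J', rfl⟩ : ∃ J', J = J' + 1 := ⟨J - 1, by omega⟩
    rw [Nat.add_sub_cancel]; ring
  omega

lemma exists_pow_ne (D : ℕ) : ∃ N : ℕ, ∀ (p : ℕ) [Fact p.Prime], N ≤ p → ∀ f : (ZMod p)[X],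
    Squarefree f → 0 < f.natDegree → f.natDegree ≤ D → f.eval 0 ≠ 0 →
    ∀ r s : ℕ, 2 ≤ r → r * s + 1 = p → ∀ c : ZMod p, ∃ x, f.eval x ≠ 0 ∧ f.eval x ^ s ≠ c := by
  classical
  obtain ⟨M, hM⟩ : ∃ M, M = 2 * D + 1 := ⟨_, rfl⟩
  obtain ⟨E, hE⟩ : ∃ E, E = M * (M * D + D + 2) + 1 := ⟨_, rfl⟩
  refine ⟨2 * D * E + D + E + M * D + M + 1, ?_⟩
  intro p _ hp f hf hdeg hD h0 r s hr hrs c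
  rcases Nat.lt_or_ge r (2 * D) with hrD | hrD
  · have hrE : r * E ≤ 2 * D * E := Nat.mul_le_mul_right E hrD.le
    refine exists_pow_ne_of_le hf hdeg hD h0 hr hrs (J := D + 1) (M := M) (E := E) (by omega)
      (by omega) ?_ ?_ c
    · have : 2 * (D + 1) * E = M * E + E := by rw [hM]; ring
      rw [this]
      have : M * (E + M * D + (D + 1) + 1) = M * E + M * (M * D + D + 2) := by ring
      rw [this]; omega
    · have h1 : 2 * s + 1 ≤ p := by nlinarith
      have h2 : M * (p - D) + M * D = M * p := by rw [← mul_add]; congr 1; omega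
      have h3 : M * p + p = p * (D + 1) + p * (D + 1) := by rw [hM]; ring
      have h4 : D * (2 * s + 1) ≤ D * p := Nat.mul_le_mul_left D h1
      nlinarith
  · by_contra! hcon
    have hs : 0 < s := by
      rcases Nat.eq_zero_or_pos s with rfl | h
      · have := (Fact.out : p.Prime).two_le; omega
      · exact h
    have hf0 : f ≠ 0 := by rintro rfl; simp at hdeg
    have hdeg' : (f ^ s - C c).natDegree = s * f.natDegree := by rw [natDegree_sub_C, natDegree_pow]
    have hne : f ^ s - C c ≠ 0 := by
      intro h
      rw [h, natDegree_zero] at hdeg'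
      have := Nat.mul_pos hs hdeg
      omega
    have hsub : (Finset.univ : Finset (ZMod p)) ⊆
        f.roots.toFinset ∪ (f ^ s - C c).roots.toFinset := by
      intro x _
      rw [Finset.mem_union, Multiset.mem_toFinset, Multiset.mem_toFinset, mem_roots hf0,
        mem_roots hne]
      by_cases hx : f.eval x = 0
      · exact Or.inl hx
      · right; simp [hcon x hx]
    have h1 := (Finset.card_le_card hsub).trans (Finset.card_union_le _ _)
    rw [Finset.card_univ, ZMod.card] at h1
    have h2 := (Multiset.toFinset_card_le f.roots).trans ((card_roots' f).trans hD)
    have h3 := (Multiset.toFinset_card_le (f ^ s - C c).roots).trans (card_roots' _)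
    rw [hdeg'] at h3
    have h4 : s * f.natDegree ≤ s * D := Nat.mul_le_mul_left s hD
    have h5 : 2 * D * s ≤ r * s := Nat.mul_le_mul_right s hrD
    nlinarith

/-- `w` is positive, and every prime factor of `w` is prime to `B` and divides a value of `f`. -/
def IsRootModulus (f : ℤ[X]) (B w : ℕ) : Prop :=
  0 < w ∧ ∀ q : ℕ, q.Prime → q ∣ w → ¬ q ∣ B ∧ ∃ m : ℕ, (q : ℤ) ∣ f.eval (m : ℤ)

lemma IsRootModulus.one (f : ℤ[X]) (B : ℕ) : IsRootModulus f B 1 :=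
  ⟨one_pos, fun _ hq h => absurd (Nat.dvd_one.mp h) hq.one_lt.ne'⟩

lemma IsRootModulus.mul {f : ℤ[X]} {B v w : ℕ} (hv : IsRootModulus f B v)
    (hw : IsRootModulus f B w) : IsRootModulus f B (v * w) :=
  ⟨Nat.mul_pos hv.1 hw.1, fun q hq h => (hq.dvd_mul.mp h).elim (hv.2 q hq) (hw.2 q hq)⟩

lemma IsRootModulus.coprime {f : ℤ[X]} {B w : ℕ} (hw : IsRootModulus f B w) :
    Nat.Coprime w B :=
  Nat.Coprime.symm (Nat.coprime_of_dvd fun q hq hB h => (hw.2 q hq h).1 hB)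

lemma exists_pow_dvd_eval_sub {f U V : ℤ[X]} {Δ : ℕ}
    (hΔ : U * f + V * derivative f = C (Δ : ℤ)) {R : ℤ} (hR : IsCoprime (Δ : ℤ) R) {m t : ℤ}
    (hm : R ∣ f.eval m) (ht : R ∣ t) (e : ℕ) : ∃ n : ℤ, R ^ (e + 1) ∣ f.eval n - t := by
  induction e with
  | zero => exact ⟨m, by rw [zero_add, pow_one]; exact dvd_sub hm ht⟩
  | succ e ih =>
    obtain ⟨n, z, hz⟩ := ih
    have hn : R ∣ f.eval n := by
      have : R ∣ f.eval n - t := hz ▸ (dvd_pow_self R e.succ_ne_zero).mul_right z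
      exact (dvd_sub_left ht).mp this
    have hcop : IsCoprime ((derivative f).eval n) R := by
      obtain ⟨y, hy⟩ := hn
      have h1 := congrArg (eval n) hΔ
      simp only [eval_add, eval_mul, eval_C] at h1
      obtain ⟨a, b, hab⟩ := hR
      refine ⟨a * V.eval n, a * U.eval n * y + b, ?_⟩
      linear_combination hab + a * h1 - a * U.eval n * hy
    obtain ⟨a, b, hab⟩ := hcop
    obtain ⟨k, hk⟩ := binomExpansion f n (R ^ (e + 1) * (-a * z))
    refine ⟨n + R ^ (e + 1) * (-a * z), b * z + k * R ^ e * (a * z) ^ 2, ?_⟩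
    rw [hk]
    have e1 : R ^ (e + 1 + 1) = R * R ^ (e + 1) := pow_succ' R (e + 1)
    have e2 : R ^ (e + 1) = R * R ^ e := pow_succ' R e
    rw [e1]
    have e3 : (k * (R ^ (e + 1) * (-a * z)) ^ 2) = R * R ^ (e + 1) * (k * R ^ e * (a * z) ^ 2) := by
      rw [e2]; ring
    linear_combination e3 + hz - R ^ (e + 1) * z * hab

lemma IsRootModulus.exists_dvd_eval_sub {f U V : ℤ[X]} {Δ : ℕ}
    (hΔ : U * f + V * derivative f = C (Δ : ℤ)) {B w : ℕ} (hw : IsRootModulus f B w)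
    (hB : Δ ∣ B) : ∃ n : ℤ, (w : ℤ) ^ 3 ∣ f.eval n - (w : ℤ) ^ 2 := by
  classical
  choose! m hm using fun q (hq : q ∈ w.primeFactors) =>
    (hw.2 q (Nat.prime_of_mem_primeFactors hq) (Nat.dvd_of_mem_primeFactors hq)).2
  obtain ⟨n, hn⟩ := Nat.chineseRemainderOfFinset m id w.primeFactors
    (fun q hq => (Nat.prime_of_mem_primeFactors hq).ne_zero)
    (fun q hq q' hq' hne => (Nat.coprime_primes (Nat.prime_of_mem_primeFactors hq)
      (Nat.prime_of_mem_primeFactors hq')).mpr hne)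
  set R := ∏ q ∈ w.primeFactors, q
  have hRn : (R : ℤ) ∣ f.eval (n : ℤ) := by
    rw [Nat.cast_prod]
    refine Finset.prod_dvd_of_coprime (fun q hq q' hq' hne => ?_) fun q hq => ?_
    · exact Nat.isCoprime_iff_coprime.mpr ((Nat.coprime_primes (Nat.prime_of_mem_primeFactors hq)
        (Nat.prime_of_mem_primeFactors hq')).mpr hne)
    · have h1 : (q : ℤ) ∣ (n : ℤ) - m q := (Nat.modEq_iff_dvd.mp (hn q hq).symm)
      exact (dvd_iff_dvd_of_dvd_sub (h1.trans (sub_dvd_eval_sub _ _ f))).mpr (hm q hq)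
  have hRw : R ∣ w := Nat.prod_primeFactors_dvd w
  have hcop : IsCoprime (Δ : ℤ) (R : ℤ) :=
    Nat.isCoprime_iff_coprime.mpr
      ((hw.coprime.coprime_dvd_right hB).coprime_dvd_left hRw).symm
  obtain ⟨k, hk⟩ : ∃ k, w ^ 3 ∣ R ^ (k + 1) := by
    refine ⟨w * 3 - 1, ?_⟩
    have h1 : w * 3 - 1 + 1 = w * 3 := by have := hw.1; omega
    rw [h1, pow_mul]
    exact pow_dvd_pow_of_dvd (Nat.dvd_prod_primeFactors_pow_self hw.1.ne') 3
  obtain ⟨N, hN⟩ := exists_pow_dvd_eval_sub hΔ hcop hRn (t := (w : ℤ) ^ 2)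
    ((Int.natCast_dvd_natCast.mpr hRw).trans (dvd_pow_self _ two_ne_zero)) k
  exact ⟨N, dvd_trans (by exact_mod_cast hk) hN⟩

lemma exists_eval_eq_mul {f : ℤ[X]} {B : ℕ} {n : ℤ}
    (hn : (((f.eval 0).natAbs * B : ℕ) : ℤ) ∣ n) : ∃ j : ℤ, f.eval n = f.eval 0 * (1 + B * j) := by
  have h1 : f.eval 0 * B ∣ f.eval n - f.eval 0 := by
    have h2 : f.eval 0 * B ∣ n - 0 := by
      rw [sub_zero]
      refine dvd_trans ?_ hn
      rw [Nat.cast_mul]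
      exact mul_dvd_mul_right (Int.dvd_natAbs.mpr dvd_rfl) _
    exact h2.trans (sub_dvd_eval_sub _ _ f)
  obtain ⟨j, hj⟩ := h1
  exact ⟨j, by linear_combination hj⟩

lemma eval_map_natCast (f : ℤ[X]) (p n : ℕ) :
    (f.map (Int.castRingHom (ZMod p))).eval (n : ZMod p) = ((f.eval (n : ℤ) : ℤ) : ZMod p) := by
  simp

lemma exists_isRootModulus_of_eval {f : ℤ[X]} {p B : ℕ} [hp : Fact p.Prime]
    (hpB : ¬ p ∣ (f.eval 0).natAbs * B) {x : ZMod p}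
    (hx : (f.map (Int.castRingHom (ZMod p))).eval x ≠ 0) :
    ∃ w : ℕ, IsRootModulus f (p * B) w ∧
      ((f.map (Int.castRingHom (ZMod p))).eval x = (f.eval 0 : ℤ) * (w : ZMod p) ∨
        (f.map (Int.castRingHom (ZMod p))).eval x = (f.eval 0 : ℤ) * -(w : ZMod p)) := by
  set A := (f.eval 0).natAbs
  obtain ⟨m, hm1, hm2⟩ := Nat.chineseRemainder
    ((Nat.Prime.coprime_iff_not_dvd hp.out).mpr hpB) x.val 0
  have hmx : (m : ZMod p) = x := by
    rw [(ZMod.natCast_eq_natCast_iff _ _ _).mpr hm1, ZMod.natCast_zmod_val]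
  obtain ⟨j, hj⟩ := exists_eval_eq_mul (f := f) (B := B) (n := (m : ℤ))
    (Int.natCast_dvd_natCast.mpr (Nat.modEq_zero_iff_dvd.mp hm2))
  set u : ℤ := 1 + B * j with hu
  have hfx : (f.map (Int.castRingHom (ZMod p))).eval x = (f.eval 0 : ℤ) * (u : ZMod p) := by
    rw [← hmx, eval_map_natCast, hj, Int.cast_mul]
  have hpm : ¬ (p : ℤ) ∣ f.eval (m : ℤ) := by
    rw [← ZMod.intCast_zmod_eq_zero_iff_dvd, ← eval_map_natCast, hmx]
    exact hx
  refine ⟨u.natAbs, ⟨?_, ?_⟩, ?_⟩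
  · rw [Nat.pos_iff_ne_zero, Int.natAbs_ne_zero]
    rintro h
    rw [hj, h, mul_zero] at hpm
    exact hpm (dvd_zero _)
  · intro q hq hqu
    have hqu' : (q : ℤ) ∣ u := Int.natCast_dvd.mpr hqu
    have hqf : (q : ℤ) ∣ f.eval (m : ℤ) := hj ▸ hqu'.mul_left _
    refine ⟨fun h => ?_, m, hqf⟩
    rcases hq.dvd_mul.mp h with h | h
    · rw [(Nat.prime_dvd_prime_iff_eq hq hp.out).mp h] at hqf
      exact hpm hqf
    · have h1 : (q : ℤ) ∣ 1 :=
        (dvd_add_left ((Int.natCast_dvd_natCast.mpr h).mul_right j)).mp (hu ▸ hqu')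
      exact hq.one_lt.ne' (Nat.dvd_one.mp (by exact_mod_cast h1))
  · rw [hfx]
    rcases Int.natAbs_eq u with h | h
    · left
      nth_rewrite 1 [h]; simp
    · right
      nth_rewrite 1 [h]; simp

lemma exists_isRootModulus_eq {f : ℤ[X]} {p B : ℕ} [hp : Fact p.Prime]
    (hpB : ¬ p ∣ (f.eval 0).natAbs * B)
    (hN : ∀ r s : ℕ, 2 ≤ r → r * s + 1 = p → ∀ c : ZMod p,
      ∃ x, (f.map (Int.castRingHom (ZMod p))).eval x ≠ 0 ∧
        (f.map (Int.castRingHom (ZMod p))).eval x ^ s ≠ c) {v : ZMod p} (hv : v ≠ 0) :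
    ∃ w : ℕ, IsRootModulus f (p * B) w ∧ (v = w ∨ v = -(w : ZMod p)) := by
  classical
  have hmul : ∀ {a b : ZMod p}, (∃ w : ℕ, IsRootModulus f (p * B) w ∧ (a = w ∨ a = -(w : ZMod p))) →
      (∃ w : ℕ, IsRootModulus f (p * B) w ∧ (b = w ∨ b = -(w : ZMod p))) →
      ∃ w : ℕ, IsRootModulus f (p * B) w ∧ (a * b = w ∨ a * b = -(w : ZMod p)) := by
    rintro a b ⟨w, hw, h⟩ ⟨w', hw', h'⟩
    refine ⟨w * w', hw.mul hw', ?_⟩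
    rcases h with rfl | rfl <;> rcases h' with rfl | rfl <;> simp
  have hone : ∃ w : ℕ, IsRootModulus f (p * B) w ∧ ((1 : ZMod p) = w ∨ (1 : ZMod p) = -(w : ZMod p)) :=
    ⟨1, .one _ _, by simp⟩
  let H : Subgroup (ZMod p)ˣ :=
    { carrier := {u | ∃ w : ℕ, IsRootModulus f (p * B) w ∧
        ((u : ZMod p) = w ∨ (u : ZMod p) = -(w : ZMod p))}
      one_mem' := by simpa using hone
      mul_mem' := fun {a b} ha hb => by simpa using hmul ha hb
      inv_mem' := fun {a} ha => by
        have hpow : ∀ k : ℕ, ∃ w : ℕ, IsRootModulus f (p * B) w ∧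
            (((a ^ k : (ZMod p)ˣ) : ZMod p) = w ∨ ((a ^ k : (ZMod p)ˣ) : ZMod p) = -(w : ZMod p)) := by
          intro k
          induction k with
          | zero => simpa using hone
          | succ k ih => rw [pow_succ]; simpa using hmul ih ha
        have e : a⁻¹ = a ^ (orderOf a - 1) := by
          rw [inv_eq_iff_mul_eq_one, ← pow_succ', Nat.sub_add_cancel (orderOf_pos a),
            pow_orderOf_eq_one]
        rw [e]
        exact hpow _ }
  suffices hH : H = ⊤ by
    have : Units.mk0 v hv ∈ H := hH ▸ Subgroup.mem_top _
    exact this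
  by_contra hH
  have hidx : H.index * Nat.card H + 1 = p := by
    rw [mul_comm, Subgroup.card_mul_index, Nat.card_eq_fintype_card, ZMod.card_units_eq_totient,
      Nat.totient_prime hp.out]
    exact Nat.sub_add_cancel hp.out.one_le
  have hidx2 : 2 ≤ H.index := by
    have h1 : H.index ≠ 1 := fun h => hH (Subgroup.index_eq_one.mp h)
    have h0 : H.index ≠ 0 := Subgroup.index_ne_zero_of_finite
    omega
  obtain ⟨x, hx, hxs⟩ := hN _ _ hidx2 hidx (((f.eval 0 : ℤ) : ZMod p) ^ Nat.card H)
  apply hxs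
  obtain ⟨w, hw, hfw⟩ := exists_isRootModulus_of_eval hpB hx
  have key : ∀ z : ZMod p, (z = w ∨ z = -(w : ZMod p)) →
      (f.map (Int.castRingHom (ZMod p))).eval x = (f.eval 0 : ℤ) * z →
      (f.map (Int.castRingHom (ZMod p))).eval x ^ Nat.card H =
        ((f.eval 0 : ℤ) : ZMod p) ^ Nat.card H := by
    intro z hz hfz
    have hz0 : z ≠ 0 := by
      rintro rfl
      exact hx (by rw [hfz, mul_zero])
    have hmem : Units.mk0 z hz0 ∈ H := ⟨w, hw, hz⟩
    have h1 : Units.mk0 z hz0 ^ Nat.card H = 1 :=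
      congrArg Subtype.val (pow_card_eq_one' (x := (⟨_, hmem⟩ : H)))
    have h2 : z ^ Nat.card H = 1 := by simpa using congrArg Units.val h1
    rw [hfz, mul_pow, h2, mul_one]
  rcases hfw with h | h
  · exact key _ (Or.inl rfl) h
  · exact key _ (Or.inr rfl) h

lemma exists_isSquare_eval {f : ℤ[X]} {p : ℕ} [hp : Fact p.Prime] (hp2 : p ≠ 2)
    (hN : ∀ r s : ℕ, 2 ≤ r → r * s + 1 = p → ∀ c : ZMod p,
      ∃ x, (f.map (Int.castRingHom (ZMod p))).eval x ≠ 0 ∧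
        (f.map (Int.castRingHom (ZMod p))).eval x ^ s ≠ c) {v : ZMod p} (hv : v ≠ 0) :
    ∃ x y : ZMod p, y ≠ 0 ∧ (f.map (Int.castRingHom (ZMod p))).eval x = v * y ^ 2 := by
  have hodd : 2 * (p / 2) + 1 = p := Nat.two_mul_div_two_add_one_of_odd (hp.out.odd_of_ne_two hp2)
  obtain ⟨x, hx, hxs⟩ := hN 2 (p / 2) le_rfl hodd (-v ^ (p / 2))
  set z := (f.map (Int.castRingHom (ZMod p))).eval x
  have h1 := ZMod.pow_div_two_eq_neg_one_or_one p hx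
  have h2 := ZMod.pow_div_two_eq_neg_one_or_one p hv
  have h3 : z ^ (p / 2) = v ^ (p / 2) := by
    rcases h1 with h1 | h1 <;> rcases h2 with h2 | h2 <;> rw [h1, h2] at hxs ⊢ <;> simp at hxs
  have h4 : IsSquare (z / v) := by
    rw [ZMod.euler_criterion p (div_ne_zero hx hv), div_pow, h3, div_self (pow_ne_zero _ hv)]
  obtain ⟨y, hy⟩ := h4
  have h5 : z = v * y ^ 2 := by rw [sq, ← hy, mul_div_cancel₀ _ hv]
  exact ⟨x, y, fun h => hx (by rw [h5, h]; ring), h5⟩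

lemma exists_squarefree_mul_sq {a : ℤ} (ha : a ≠ 0) :
    ∃ c : ℤ, ∃ b : ℕ, 0 < b ∧ Squarefree c ∧ a = c * (b : ℤ) ^ 2 := by
  obtain ⟨c, b, hcb, hc⟩ := Nat.sq_mul_squarefree a.natAbs
  have hb : 0 < b := by
    rcases Nat.eq_zero_or_pos b with rfl | h
    · exact absurd (Int.natAbs_eq_zero.mp (by simpa using hcb.symm)) ha
    · exact h
  rcases Int.natAbs_eq a with h | h
  · exact ⟨c, b, hb, Int.squarefree_natCast.mpr hc, by rw [h, ← hcb]; push_cast; ring⟩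
  · refine ⟨-c, b, hb, ?_, by rw [h, ← hcb]; push_cast; ring⟩
    rw [← Int.squarefree_natAbs, Int.natAbs_neg, Int.natAbs_natCast]
    exact hc

lemma infinite_of_forall_exists_eval {f : ℤ[X]} (hf : 0 < f.natDegree) {S : Set ℤ} {z : ℤ}
    (h : ∀ T : ℕ, ∃ n : ℕ, T ≤ n ∧ ∃ d ∈ S, f.eval (n : ℤ) = z * d) : S.Infinite := by
  intro hS
  have h1 : ((fun n : ℕ => f.eval (n : ℤ)) ⁻¹' ((fun d => z * d) '' S)).Finite := by
    refine (hS.image _).preimage' fun v _ => ?_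
    have hne : f - C v ≠ 0 := by
      intro h0
      have := natDegree_sub_C (p := f) (a := v)
      rw [h0, natDegree_zero] at this
      omega
    refine ((f - C v).roots.toFinset.finite_toSet.preimage
      (Nat.cast_injective (R := ℤ)).injOn).subset fun n hn => ?_
    have hn' : f.eval (n : ℤ) = v := hn
    rw [Set.mem_preimage, Finset.mem_coe, Multiset.mem_toFinset, mem_roots hne]
    simp [hn']
  obtain ⟨T, hT⟩ := h1.bddAbove
  obtain ⟨n, hn, d, hd, hnd⟩ := h (T + 1)
  have := hT (show n ∈ _ from ⟨d, hd, hnd.symm⟩)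
  omega

lemma squarefree_of_not_prime_sq_dvd {d : ℤ} (h : ∀ q : ℕ, q.Prime → ¬ (q : ℤ) ^ 2 ∣ d) :
    Squarefree d := by
  rw [← Int.squarefree_natAbs, Nat.squarefree_iff_prime_squarefree]
  intro q hq hd
  refine h q hq ?_
  rw [← sq] at hd
  exact_mod_cast Int.natCast_dvd.mpr hd

lemma squarefree_twist {f : ℤ[X]} {p B w b n : ℕ} {c d i : ℤ} (hp : p.Prime)
    (hc : Squarefree c) (hcb : f.eval 0 = c * (b : ℤ) ^ 2) (hb : 0 < b)
    (hpd : ¬ (p : ℤ) ∣ d)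
    (hd : f.eval (n : ℤ) = ((b : ℤ) * w) ^ 2 * d) (hwd : (b : ℤ) ^ 2 * d = 1 + w * i)
    (hn : (((f.eval 0).natAbs * ((f.eval 0).natAbs * B) : ℕ) : ℤ) ∣ n)
    (hsieve : ∀ q : ℕ, q.Prime →
      ¬ q ∣ p * ((f.eval 0).natAbs * ((f.eval 0).natAbs * B)) * w ^ 3 →
      ¬ (q : ℤ) ^ 2 ∣ f.eval (n : ℤ)) : Squarefree d := by
  refine squarefree_of_not_prime_sq_dvd fun q hq hqd => ?_
  have hqZ : Prime (q : ℤ) := Nat.prime_iff_prime_int.mp hq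
  have hqd1 : (q : ℤ) ∣ d := (dvd_pow_self _ two_ne_zero).trans hqd
  by_cases hqw : q ∣ w
  · have h1 : (q : ℤ) ∣ 1 :=
      (dvd_add_left ((Int.natCast_dvd_natCast.mpr hqw).mul_right i)).mp (hwd ▸ hqd1.mul_left _)
    exact hq.one_lt.ne' (Nat.dvd_one.mp (by exact_mod_cast h1))
  by_cases hqp : q = p
  · exact hpd (hqp ▸ hqd1)
  by_cases hqB : q ∣ (f.eval 0).natAbs * B
  · obtain ⟨j, hj⟩ := exists_eval_eq_mul hn
    have hb0 : (b : ℤ) ^ 2 ≠ 0 := by positivity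
    have h1 : c * (1 + (((f.eval 0).natAbs * B : ℕ) : ℤ) * j) = (w : ℤ) ^ 2 * d := by
      refine mul_left_cancel₀ hb0 ?_
      rw [hd, hcb] at hj
      rw [hcb]
      linear_combination -hj
    have h2 : IsCoprime ((q : ℤ) ^ 2) (1 + (((f.eval 0).natAbs * B : ℕ) : ℤ) * j) := by
      refine (hqZ.coprime_iff_not_dvd.mpr fun h => ?_).pow_left
      have h1 : (q : ℤ) ∣ 1 :=
        (dvd_add_left ((Int.natCast_dvd_natCast.mpr hqB).mul_right j)).mp h
      exact hq.one_lt.ne' (Nat.dvd_one.mp (by exact_mod_cast h1))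
    have h3 : (q : ℤ) ^ 2 ∣ c := h2.dvd_of_dvd_mul_right (h1 ▸ hqd.mul_left _)
    exact hqZ.not_isUnit (hc _ (by rwa [← sq]))
  · refine hsieve q hq ?_ (hd ▸ hqd.mul_left _)
    intro h
    rcases hq.dvd_mul.mp h with h | h
    · rcases hq.dvd_mul.mp h with h | h
      · exact hqp ((Nat.prime_dvd_prime_iff_eq hq hp).mp h)
      · rcases hq.dvd_mul.mp h with h | h
        · exact hqB (h.mul_right _)
        · exact hqB h
    · exact hqw (hq.dvd_of_dvd_pow h)

lemma AbcConjecture.infinite_twists (habc : AbcConjecture) {f : ℤ[X]} (hdeg : 0 < f.natDegree)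
    (hsep : (f.map (Int.castRingHom ℚ)).Separable) (h0 : f.eval 0 ≠ 0) :
    ∃ N₀ : ℕ, ∀ p : ℕ, p.Prime → N₀ ≤ p → ∀ k : ℤ, ¬ ((p : ℤ) ∣ k) →
      {d : ℤ | Squarefree d ∧ d ≡ k [ZMOD (p : ℤ)] ∧
        ∃ x y : ℚ, y ≠ 0 ∧ (d : ℚ) * y ^ 2 = aeval x f}.Infinite := by
  classical
  obtain ⟨Δ, hΔ0, U, V, hΔ⟩ := exists_bezout f hsep
  obtain ⟨c, b, hb, hc, hcb⟩ := exists_squarefree_mul_sq h0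
  obtain ⟨N, hN⟩ := exists_pow_ne f.natDegree
  set A := (f.eval 0).natAbs with hA
  have hA0 : 0 < A := Int.natAbs_pos.mpr h0
  set Q := Δ + 8 * f.natDegree with hQ
  refine ⟨N + Q + A + f.leadingCoeff.natAbs + 3, fun p hp hpN k hk => ?_⟩
  have := Fact.mk hp
  have hpsmall : ∀ a : ℕ, 0 < a → a < p → ¬ p ∣ a := fun a ha hap h => by
    have := Nat.le_of_dvd ha h; omega
  have hpQ : ¬ p ∣ Q.factorial := by
    rw [hp.dvd_factorial]; omega
  have hpA : ¬ p ∣ A := hpsmall A hA0 (by omega)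
  have hpΔ : ¬ p ∣ Δ := hpsmall Δ hΔ0 (by omega)
  have hplead : ((f.leadingCoeff : ℤ) : ZMod p) ≠ 0 := by
    rw [Ne, ZMod.intCast_zmod_eq_zero_iff_dvd, Int.natCast_dvd]
    refine hpsmall _ (Int.natAbs_pos.mpr ?_) (by omega)
    rw [Ne, leadingCoeff_eq_zero]
    rintro rfl
    simp at hdeg
  have hpAB : ¬ p ∣ A * (A * Q.factorial) := fun h =>
    (hp.dvd_mul.mp h).elim hpA fun h => (hp.dvd_mul.mp h).elim hpA hpQ
  set F := f.map (Int.castRingHom (ZMod p)) with hF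
  have hFdeg : F.natDegree = f.natDegree :=
    natDegree_map_of_leadingCoeff_ne_zero _ (by simpa using hplead)
  have hFsep : F.Separable := by
    have h1 := congrArg (Polynomial.map (Int.castRingHom (ZMod p))) hΔ
    simp only [Polynomial.map_add, Polynomial.map_mul, ← derivative_map, map_C, ← hF] at h1
    have hΔ' : (Δ : ZMod p) ≠ 0 := by rwa [Ne, ZMod.natCast_eq_zero_iff]
    refine ⟨C (Δ : ZMod p)⁻¹ * U.map (Int.castRingHom (ZMod p)),
      C (Δ : ZMod p)⁻¹ * V.map (Int.castRingHom (ZMod p)), ?_⟩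
    rw [mul_assoc, mul_assoc, ← mul_add, h1, ← C_mul, eq_intCast, Int.cast_natCast,
      inv_mul_cancel₀ hΔ', C_1]
  have hF0 : F.eval 0 ≠ 0 := by
    have := eval_map_natCast f p 0
    rw [Nat.cast_zero, Nat.cast_zero] at this
    rw [hF, this, Ne, ZMod.intCast_zmod_eq_zero_iff_dvd, Int.natCast_dvd]
    exact hpA
  have hW := hN p (by omega) F hFsep.squarefree (hFdeg ▸ hdeg) hFdeg.le hF0
  have hkp : (k : ZMod p) ≠ 0 := by rwa [Ne, ZMod.intCast_zmod_eq_zero_iff_dvd]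
  have hbp : (b : ZMod p) ≠ 0 := by
    rw [Ne, ZMod.natCast_eq_zero_iff]
    intro h
    refine hpA (Int.natCast_dvd.mp ?_)
    rw [hcb]
    exact ((Int.natCast_dvd_natCast.mpr h).trans (dvd_pow_self _ two_ne_zero)).mul_left c
  obtain ⟨x, y, hy, hxy⟩ := exists_isSquare_eval (f := f) (by omega) hW hkp
  obtain ⟨w, hw, hyw⟩ := exists_isRootModulus_eq (f := f) (B := A * Q.factorial) hpAB hW
    (div_ne_zero hy hbp)
  have hxw : F.eval x = k * ((b : ZMod p) * w) ^ 2 := by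
    have h1 : y = b * (y / b) := (mul_div_cancel₀ y hbp).symm
    rw [hxy, h1]
    rcases hyw with h | h
    · rw [h]
    · rw [h]; ring
  have hwp : (w : ZMod p) ≠ 0 := by
    intro h
    have h1 : y / b = 0 := by simpa [h] using hyw
    exact div_ne_zero hy hbp h1
  have hΔQ : Δ ∣ p * (A * Q.factorial) :=
    ((Nat.dvd_factorial hΔ0 (by omega)).mul_left _).mul_left _
  obtain ⟨m, hm⟩ := hw.exists_dvd_eval_sub hΔ hΔQ
  set E := A * (A * Q.factorial) with hE
  have hE0 : 0 < E := by positivity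
  have hcop1 : Nat.Coprime p E := (Nat.Prime.coprime_iff_not_dvd hp).mpr hpAB
  have hwpE : Nat.Coprime w (p * E) := by
    have h1 := hw.coprime
    have h2 : Nat.Coprime w A := h1.coprime_dvd_right ⟨p * Q.factorial, by ring⟩
    have h3 : p * E = (p * (A * Q.factorial)) * A := by rw [hE]; ring
    rw [h3]
    exact h1.mul_right h2
  obtain ⟨n₀, hn₀p, hn₀E⟩ := Nat.chineseRemainder hcop1 x.val 0
  obtain ⟨n₁, hn₁, hn₁w⟩ := Nat.chineseRemainder (hwpE.symm.pow_right 3) n₀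
    (m % ((w ^ 3 : ℕ) : ℤ)).toNat
  have hw0 := hw.1
  have hL0 : 0 < p * E * w ^ 3 := by have := hp.pos; positivity
  have hLQ : ∀ q : ℕ, q.Prime → q ≤ Q → q ∣ p * E * w ^ 3 := fun q hq hqQ =>
    ((((hq.dvd_factorial.mpr hqQ).mul_left A).mul_left A).mul_left p).mul_right _
  refine infinite_of_forall_exists_eval hdeg (z := ((b : ℤ) * w) ^ 2) fun T => ?_
  obtain ⟨n, hnT, hnn, hsieve⟩ := habc.exists_squarefree_outside hsep hΔ0 hΔ hdeg (Q := Q)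
    (by omega) (by omega) hL0 hLQ n₁ T
  have hnpE : n ≡ n₀ [MOD p * E] := (hnn.of_mul_right _).trans hn₁
  have hnx : (n : ZMod p) = x := by
    rw [(ZMod.natCast_eq_natCast_iff _ _ _).mpr ((hnpE.of_mul_right _).trans hn₀p),
      ZMod.natCast_zmod_val]
  have hnE : ((E : ℕ) : ℤ) ∣ (n : ℤ) :=
    Int.natCast_dvd_natCast.mpr (Nat.modEq_zero_iff_dvd.mp ((hnpE.of_mul_left _).trans hn₀E))
  have hnw : (w : ℤ) ^ 3 ∣ f.eval (n : ℤ) - (w : ℤ) ^ 2 := by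
    have h1 : n ≡ (m % ((w ^ 3 : ℕ) : ℤ)).toNat [MOD w ^ 3] := (hnn.of_mul_left _).trans hn₁w
    have hw3 : ((w ^ 3 : ℕ) : ℤ) ≠ 0 := by positivity
    have h2 : (n : ℤ) ≡ m [ZMOD ((w ^ 3 : ℕ) : ℤ)] := by
      have := (Int.natCast_modEq_iff.mpr h1)
      rw [Int.toNat_of_nonneg (Int.emod_nonneg _ hw3)] at this
      exact this.trans (Int.mod_modEq _ _)
    have h3 : (w : ℤ) ^ 3 ∣ (n : ℤ) - m := by
      have := h2.symm.dvd
      rwa [Nat.cast_pow] at this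
    have h4 := dvd_add (h3.trans (sub_dvd_eval_sub (n : ℤ) m f)) hm
    rwa [sub_add_sub_cancel] at h4
  obtain ⟨i, hi⟩ := hnw
  have hfw : f.eval (n : ℤ) = (w : ℤ) ^ 2 * (1 + w * i) := by linear_combination hi
  obtain ⟨d, hd⟩ : (b : ℤ) ^ 2 ∣ 1 + w * i := by
    have hbA : b ∣ A := by
      refine Int.natCast_dvd_natCast.mp (Int.dvd_natAbs.mpr ?_)
      rw [hcb]
      exact (dvd_pow_self _ two_ne_zero).mul_left c
    have h1 : IsCoprime ((b : ℤ) ^ 2) ((w : ℤ) ^ 2) := by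
      refine IsCoprime.pow (Nat.isCoprime_iff_coprime.mpr ?_)
      exact (hw.coprime.coprime_dvd_right
        ((hbA.mul_right _).mul_left _)).symm
    refine h1.dvd_of_dvd_mul_left ?_
    rw [← hfw]
    obtain ⟨j, hj⟩ := exists_eval_eq_mul hnE
    rw [hj, hcb]
    exact ((dvd_mul_left _ c).mul_right _)
  have hfd : f.eval (n : ℤ) = ((b : ℤ) * w) ^ 2 * d := by
    rw [hfw, hd]; ring
  have hdk : (d : ZMod p) = k := by
    have h1 := eval_map_natCast f p n
    rw [hnx, ← hF, hxw, hfd] at h1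
    push_cast at h1
    refine mul_left_cancel₀ (pow_ne_zero 2 (mul_ne_zero hbp hwp)) ?_
    rw [← h1]; ring
  have hpd : ¬ (p : ℤ) ∣ d := by
    rw [← ZMod.intCast_zmod_eq_zero_iff_dvd, hdk]
    exact hkp
  refine ⟨n, hnT, d, ⟨?_, ?_, ?_⟩, hfd⟩
  · exact squarefree_twist hp hc hcb hb hpd hfd hd.symm hnE hsieve
  · exact (ZMod.intCast_eq_intCast_iff _ _ _).mp hdk
  · refine ⟨n, (b : ℚ) * w, by positivity, ?_⟩
    have h1 : aeval ((n : ℤ) : ℚ) f = ((f.eval (n : ℤ) : ℤ) : ℚ) := by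
      have := aeval_algebraMap_apply ℚ (n : ℤ) f
      simpa using this
    rw [Int.cast_natCast] at h1
    rw [h1, hfd]
    push_cast; ring

theorem stmt_2 (f : Polynomial ℤ) (hdeg : 0 < f.natDegree)
    (hsep : (f.map (Int.castRingHom ℚ)).Separable)
    (habc : AbcConjecture) :
    ∃ N₀ : ℕ, ∀ p : ℕ, p.Prime → N₀ ≤ p → ∀ k : ℤ, ¬ ((p : ℤ) ∣ k) →
      {d : ℤ | Squarefree d ∧ d ≡ k [ZMOD (p : ℤ)] ∧
        ∃ x y : ℚ, y ≠ 0 ∧ (d : ℚ) * y ^ 2 = Polynomial.aeval x f}.Infinite := by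
  have hf0 : f ≠ 0 := by rintro rfl; simp at hdeg
  obtain ⟨a, ha⟩ : ∃ a : ℤ, f.eval a ≠ 0 := by
    by_contra! h
    exact hf0 (funext fun a => by rw [h a, eval_zero])
  have hmap : (f.comp (X + C a)).map (Int.castRingHom ℚ) =
      (f.map (Int.castRingHom ℚ)).comp (X + C (a : ℚ)) := by
    rw [map_comp]; simp
  have hsep' : ((f.comp (X + C a)).map (Int.castRingHom ℚ)).Separable := by
    have hder : derivative ((f.map (Int.castRingHom ℚ)).comp (X + C (a : ℚ))) =
        (derivative (f.map (Int.castRingHom ℚ))).comp (X + C (a : ℚ)) := by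
      rw [derivative_comp]; simp
    rw [hmap, separable_def, hder]
    exact IsCoprime.map hsep (compRingHom (X + C (a : ℚ)))
  obtain ⟨N₀, hN₀⟩ := habc.infinite_twists (f := f.comp (X + C a))
    (by rwa [natDegree_comp, natDegree_X_add_C, mul_one]) hsep' (by simpa using ha)
  refine ⟨N₀, fun p hp hpN k hk => (hN₀ p hp hpN k hk).mono ?_⟩
  rintro d ⟨hd, hdk, x, y, hy, hxy⟩
  refine ⟨hd, hdk, x + a, y, hy, ?_⟩
  rw [hxy, aeval_comp]
  simp
end
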